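/- There exists an absolute constant K>0 such that for every p with 1<p<∞, every ψ∈𝔐_∞^+, every β∈ℝ, every modulus of continuity ω, and every n∈ℕ with μ(ψ;n)>2, one has E_n(L^ψ_β H_{ω_{L_p}})_{L_p} ≤ (2/π)·ψ(n)·e_n(ω) + K·γ_n(ψ)·ω(1/n). -/

import Mathlib

open Real MeasureTheory Filter

noncomputable section

/-- `ω` is a modulus of continuity: continuous, nondecreasing, subadditive on `[0,∞)`,
nonnegative, and `ω 0 = 0`. -/
def IsModulus (ω : ℝ → ℝ) : Prop :=
  ContinuousOn ω (Set.Ici 0) ∧ MonotoneOn ω (Set.Ici 0) ∧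
  (∀ s t : ℝ, 0 ≤ s → 0 ≤ t → ω (s + t) ≤ ω s + ω t) ∧ ω 0 = 0 ∧
  ∀ t : ℝ, 0 ≤ t → 0 ≤ ω t

/-- `ψ` belongs to `𝔐_∞^+`, where `η t = ψ⁻¹(ψ t / 2)` (i.e. `η t ≥ t` and
`ψ (η t) = ψ t / 2`) and `μ t = t / (η t − t)` is nondecreasing and tends to `∞`. -/
def IsMInfPlus (ψ η : ℝ → ℝ) : Prop :=
  (∀ t ≥ (1:ℝ), 0 < ψ t) ∧ ContinuousOn ψ (Set.Ici 1) ∧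
  ConvexOn ℝ (Set.Ici 1) ψ ∧ Tendsto ψ atTop (nhds 0) ∧
  (∀ t ≥ (1:ℝ), t < η t ∧ ψ (η t) = ψ t / 2) ∧
  MonotoneOn (fun t => t / (η t - t)) (Set.Ici 1) ∧
  Tendsto (fun t => t / (η t - t)) atTop atTop

/-- `T` is a trigonometric polynomial of degree at most `n − 1`. -/
def IsTrigPoly (n : ℕ) (T : ℝ → ℝ) : Prop :=
  ∃ a b : ℕ → ℝ,
    ∀ x, T x = ∑ k ∈ Finset.range n, (a k * Real.cos (k * x) + b k * Real.sin (k * x))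

/-- The kernel `Ψ_β(t) = ∑_{k=1}^∞ ψ(k) cos(kt − βπ/2)`. -/
def PsiKer (ψ : ℝ → ℝ) (β : ℝ) (t : ℝ) : ℝ :=
  ∑' k : ℕ, ψ (k + 1) * Real.cos ((k + 1) * t - β * π / 2)

/-- The `L_p` norm over one period: `‖g‖_p = (∫_{−π}^{π} |g|^p)^{1/p}`. -/
def LpNormP (p : ℝ) (g : ℝ → ℝ) : ℝ := (∫ x in (-π)..π, |g x| ^ p) ^ (1 / p)

/-- `g` belongs to `L_p` over one period. -/
def MemLpP (p : ℝ) (g : ℝ → ℝ) : Prop :=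
  AEStronglyMeasurable g volume ∧
    IntervalIntegrable (fun x => |g x| ^ p) volume (-π) π

/-- The class `L^ψ_β H_{ω_{L_p}}`. -/
def LpClass (p : ℝ) (ψ : ℝ → ℝ) (β : ℝ) (ω : ℝ → ℝ) : Set (ℝ → ℝ) :=
  {f | MemLpP p f ∧ Function.Periodic f (2 * π) ∧
    ∃ a₀ : ℝ, ∃ φ : ℝ → ℝ, MemLpP p φ ∧ Function.Periodic φ (2 * π) ∧
      (∫ t in (-π)..π, φ t) = 0 ∧
      (∀ t : ℝ, 0 ≤ t → ∀ h : ℝ, |h| ≤ t →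
        LpNormP p (fun x => φ (x + h) - φ x) ≤ ω t) ∧
      ∀ᵐ x : ℝ, f x = a₀ / 2 + (1 / π) * ∫ t in (-π)..π, φ (x - t) * PsiKer ψ β t}

/-- Best `L_p` approximation of `f` by trigonometric polynomials of degree `≤ n − 1`. -/
def EnLp (p : ℝ) (n : ℕ) (f : ℝ → ℝ) : ℝ :=
  sInf {e | ∃ T : ℝ → ℝ, IsTrigPoly n T ∧ e = LpNormP p (fun x => f x - T x)}

/-- Best `L_p` approximation of a class of functions. -/
def EnLpClass (p : ℝ) (n : ℕ) (N : Set (ℝ → ℝ)) : ℝ := sSup (EnLp p n '' N)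

/-- `e_n(ω) = ∫_0^{π/2} ω(2t/n) sin t dt`. -/
def eN (n : ℕ) (ω : ℝ → ℝ) : ℝ := ∫ t in (0:ℝ)..(π / 2), ω (2 * t / n) * Real.sin t

/-- `γ_n(ψ) = ψ(n+1)(1/n + 1/(μ(n)−2)) + ψ(3n)(1 + ln⁺(η(n)−n))`. -/
def gammaN (ψ η : ℝ → ℝ) (n : ℕ) : ℝ :=
  ψ (n + 1) * (1 / n + 1 / ((n : ℝ) / (η n - n) - 2)) +
    ψ (3 * n) * (1 + max 0 (Real.log (η n - n)))


lemma psi_antitone {ψ η : ℝ → ℝ} (h : IsMInfPlus ψ η) : AntitoneOn ψ (Set.Ici 1) := by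
  obtain ⟨hpos, hcont, hconv, hlim, -, -, -⟩ := h
  intro x hx y hy hxy
  by_contra hlt
  push Not at hlt
  have hxy' : x < y := by
    rcases hxy.lt_or_eq with h | h
    · exact h
    · subst h; exact absurd hlt (lt_irrefl _)
  have key : ∀ z, y < z → ψ y ≤ ψ z := by
    intro z hz
    have hx1 : (1:ℝ) ≤ x := hx
    have := hconv.le_max_of_mem_Icc hx (show (1:ℝ) ≤ z by linarith) (⟨hxy, hz.le⟩ : y ∈ Set.Icc x z)
    rcases le_max_iff.1 this with h | h
    · linarith
    · exact h
  have h0 : ψ y ≤ 0 := by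
    refine ge_of_tendsto hlim ?_
    filter_upwards [eventually_gt_atTop y] with z hz using key z hz
  exact absurd (hpos y hy) (not_lt.2 h0)

lemma psi_sum_bound {ψ η : ℝ → ℝ} (h : IsMInfPlus ψ η) (N : ℕ) (hN : 1 ≤ N)
    (hmu : 2 < (N : ℝ) / (η N - N)) :
    Summable (fun m : ℕ => ψ (N + m)) ∧
      ∑' m : ℕ, ψ (N + m) ≤ ψ N * (1 + 4 * (η N - N)) := by
  have hanti := psi_antitone h
  obtain ⟨hpos, hcont, hconv, hlim, heta, hmono, -⟩ := h
  have hN1 : (1:ℝ) ≤ N := by exact_mod_cast hN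
  have hd : 0 < η N - N := by have := (heta N hN1).1; linarith
  set d := η N - N with hdd
  set r := d / N with hr
  have hNpos : (0:ℝ) < N := by linarith
  have hrpos : 0 < r := by positivity
  have hrhalf : r < 1 / 2 := by
    rw [lt_div_iff₀ hd] at hmu
    rw [hr, div_lt_iff₀ hNpos]; linarith
  have hhalf : ∀ t, (N:ℝ) ≤ t → ψ ((1 + r) * t) ≤ ψ t / 2 := by
    intro t ht
    have ht1 : 1 ≤ t := hN1.trans ht
    obtain ⟨h1, h2⟩ := heta t ht1
    have hm : (N:ℝ) / d ≤ t / (η t - t) := hmono (show (N:ℝ) ∈ Set.Ici 1 from hN1) (show t ∈ Set.Ici 1 from ht1) ht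
    have h3 : 0 < η t - t := by linarith
    have h4 : η t - t ≤ r * t := by
      rw [div_le_div_iff₀ hd h3] at hm
      rw [hr, div_mul_eq_mul_div, le_div_iff₀ hNpos]; linarith
    rw [← h2]
    refine hanti (show (1:ℝ) ≤ η t by linarith) ?_ (by linarith)
    show (1:ℝ) ≤ _
    nlinarith
  have hInt : ∀ a b, (1:ℝ) ≤ a → 1 ≤ b → IntervalIntegrable ψ volume a b := by
    intro a b ha hb
    apply ContinuousOn.intervalIntegrable
    apply hcont.mono
    intro x hx
    rcases Set.mem_uIcc.1 hx with h | h
    · exact ha.trans h.1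
    · exact hb.trans h.1
  have hI : ∀ X, (1 + r) * N ≤ X → ∫ t in (N:ℝ)..X, ψ t ≤ 4 * d * ψ N := by
    intro X hX
    have hrN : r * N = d := by rw [hr]; field_simp
    have hNX : (N:ℝ) ≤ X := by nlinarith
    have hX1 : 1 ≤ X := hN1.trans hNX
    have hA1 : 1 ≤ (1 + r) * N := by nlinarith
    have hXX : X ≤ (1 + r) * X := by nlinarith
    have e1 : ∫ t in (N:ℝ)..X, ψ t = (∫ t in (N:ℝ)..((1 + r) * N), ψ t) + ∫ t in ((1+r) * N)..X, ψ t :=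
      (intervalIntegral.integral_add_adjacent_intervals (hInt _ _ hN1 hA1) (hInt _ _ hA1 hX1)).symm
    have e2 : ∫ t in ((1+r) * N)..X, ψ t ≤ ∫ t in ((1+r) * N)..((1 + r) * X), ψ t := by
      rw [← intervalIntegral.integral_add_adjacent_intervals (hInt _ _ hA1 hX1) (hInt X ((1+r)*X) hX1 (hX1.trans hXX))]
      have : 0 ≤ ∫ t in X..((1+r) * X), ψ t := by
        apply intervalIntegral.integral_nonneg hXX
        intro u hu
        exact (hpos u (hX1.trans hu.1)).le
      linarith
    have e3 : ∫ t in ((1+r) * N)..((1 + r) * X), ψ t = (1 + r) * ∫ t in (N:ℝ)..X, ψ ((1 + r) * t) := by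
      rw [intervalIntegral.integral_comp_mul_left _ (by positivity)]
      simp; field_simp
    have e4 : ∫ t in (N:ℝ)..X, ψ ((1 + r) * t) ≤ ∫ t in (N:ℝ)..X, ψ t / 2 := by
      apply intervalIntegral.integral_mono_on hNX
      · apply ContinuousOn.intervalIntegrable
        apply hcont.comp (by fun_prop)
        intro x hx
        rw [Set.uIcc_of_le hNX] at hx
        show (1:ℝ) ≤ _
        nlinarith [hx.1]
      · exact (hInt _ _ hN1 hX1).div_const 2
      · intro x hx; exact hhalf x hx.1
    have e5 : ∫ t in (N:ℝ)..((1 + r) * N), ψ t ≤ d * ψ N := by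
      have : ∫ t in (N:ℝ)..((1 + r) * N), ψ t ≤ ∫ t in (N:ℝ)..((1 + r) * N), ψ N := by
        apply intervalIntegral.integral_mono_on (by nlinarith) (hInt _ _ hN1 hA1) (by simp)
        intro x hx
        exact hanti hN1 (hN1.trans hx.1) hx.1
      rw [intervalIntegral.integral_const, smul_eq_mul] at this
      have e : (1 + r) * (N:ℝ) - N = d := by linarith
      rwa [e] at this
    rw [intervalIntegral.integral_div] at e4
    have hI0 : 0 ≤ ∫ t in (N:ℝ)..X, ψ t := by
      apply intervalIntegral.integral_nonneg hNX
      intro u hu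
      exact (hpos u (hN1.trans hu.1)).le
    have e6 : (1 + r) * ∫ t in (N:ℝ)..X, ψ ((1 + r) * t) ≤ (1 + r) * ((∫ t in (N:ℝ)..X, ψ t)/2) :=
      mul_le_mul_of_nonneg_left e4 (by positivity)
    nlinarith
  have hpart : ∀ M : ℕ, ∑ m ∈ Finset.range M, ψ (N + m) ≤ ψ N * (1 + 4 * d) := by
    intro M
    have h1 : ∑ m ∈ Finset.range M, ψ (N + (m + 1 : ℕ)) ≤ ∫ t in (N:ℝ)..(N + M), ψ t := by
      apply AntitoneOn.sum_le_integral
      exact hanti.mono (fun x hx => hN1.trans hx.1)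
    have h2 : ∫ t in (N:ℝ)..(N + M), ψ t ≤ 4 * d * ψ N := by
      set X := max ((N:ℝ) + M) ((1 + r) * N)
      have hXle : (N:ℝ) + M ≤ X := le_max_left _ _
      have hM0 : (0:ℝ) ≤ M := by positivity
      have := hI X (le_max_right _ _)
      rw [← intervalIntegral.integral_add_adjacent_intervals (hInt N (N+M) hN1 (by linarith)) (hInt _ X (by linarith) (by linarith))] at this
      have h3 : 0 ≤ ∫ t in ((N:ℝ)+M)..X, ψ t := by
        apply intervalIntegral.integral_nonneg hXle
        intro u hu
        exact (hpos u (by linarith [hu.1])).le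
      linarith
    have h3 : ∑ m ∈ Finset.range M, ψ (N + m) ≤ ∑ m ∈ Finset.range (M+1), ψ (N + m) := by
      apply Finset.sum_le_sum_of_subset_of_nonneg
      · intro x; simp; omega
      · intro i _ _
        exact (hpos _ (by have : (0:ℝ) ≤ i := by positivity
                          linarith)).le
    rw [Finset.sum_range_succ'] at h3
    simp only [Nat.cast_zero, add_zero] at h3
    linarith
  have hnn : ∀ m : ℕ, 0 ≤ ψ (N + m) := fun i =>
    (hpos _ (by have : (0:ℝ) ≤ i := by positivity
                linarith)).le
  exact ⟨summable_of_sum_range_le hnn hpart, Real.tsum_le_of_sum_range_le hnn hpart⟩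


lemma tp_add {n : ℕ} {S T : ℝ → ℝ} (hS : IsTrigPoly n S) (hT : IsTrigPoly n T) :
    IsTrigPoly n (fun x => S x + T x) := by
  obtain ⟨a, b, h⟩ := hS
  obtain ⟨c, d, h'⟩ := hT
  refine ⟨fun k => a k + c k, fun k => b k + d k, fun x => ?_⟩
  simp only [h, h', ← Finset.sum_add_distrib]
  exact Finset.sum_congr rfl fun k _ => by ring

lemma tp_smul {n : ℕ} {S : ℝ → ℝ} (c : ℝ) (hS : IsTrigPoly n S) :
    IsTrigPoly n (fun x => c * S x) := by
  obtain ⟨a, b, h⟩ := hS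
  refine ⟨fun k => c * a k, fun k => c * b k, fun x => ?_⟩
  simp only [h, Finset.mul_sum]
  exact Finset.sum_congr rfl fun k _ => by ring

lemma tp_zero (n : ℕ) : IsTrigPoly n (fun _ => 0) :=
  ⟨fun _ => 0, fun _ => 0, fun x => by simp⟩

lemma tp_sum {n : ℕ} {ι : Type*} (s : Finset ι) (S : ι → ℝ → ℝ) (h : ∀ i ∈ s, IsTrigPoly n (S i)) :
    IsTrigPoly n (fun x => ∑ i ∈ s, S i x) := by
  classical
  induction s using Finset.induction_on with
  | empty => simpa using tp_zero n
  | insert i s hi ih =>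
    simp only [Finset.sum_insert hi]
    exact tp_add (h i (by simp)) (ih fun j hj => h j (by simp [hj]))

lemma tp_cos {n : ℕ} (z : ℤ) (hz : z.natAbs < n) (c : ℝ) :
    IsTrigPoly n (fun x => Real.cos (z * x + c)) := by
  have hnat : ∀ k : ℕ, k < n → ∀ c : ℝ, IsTrigPoly n (fun x => Real.cos (k * x + c)) := by
    intro k hk c
    refine ⟨fun j => if j = k then Real.cos c else 0, fun j => if j = k then - Real.sin c else 0, fun x => ?_⟩
    rw [Finset.sum_eq_single k]
    · simp [Real.cos_add]; ring
    · intro j _ hj; simp [hj]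
    · intro h; simp at h; omega
  obtain ⟨k, rfl | rfl⟩ := z.eq_nat_or_neg
  · have := hnat k (by simpa using hz) c
    simpa using this
  · have := hnat k (by simpa using hz) (-c)
    convert this using 2 with x
    rw [← Real.cos_neg]; congr 1; push_cast; ring

lemma tp_const {n : ℕ} (hn : 1 ≤ n) (c : ℝ) : IsTrigPoly n (fun _ => c) := by
  have := tp_smul c (tp_cos (n := n) 0 (by simp; omega) 0)
  simpa using this

lemma tp_cont {n : ℕ} {T : ℝ → ℝ} (hT : IsTrigPoly n T) : Continuous T := by
  obtain ⟨a, b, h⟩ := hT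
  rw [funext h]; fun_prop

lemma tp_per {n : ℕ} {T : ℝ → ℝ} (hT : IsTrigPoly n T) : Function.Periodic T (2 * π) := by
  obtain ⟨a, b, h⟩ := hT
  intro x
  rw [h, h]
  refine Finset.sum_congr rfl fun k _ => ?_
  have e : (k:ℝ) * (x + 2 * π) = k * x + k * (2 * π) := by ring
  rw [e, Real.cos_add_nat_mul_two_pi, Real.sin_add_nat_mul_two_pi]

lemma tp_conv {n : ℕ} {T : ℝ → ℝ} (hT : IsTrigPoly n T) {W : ℝ → ℝ} {a b : ℝ}
    (hW : IntervalIntegrable W volume a b) (c : ℝ) :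
    IsTrigPoly n (fun x => ∫ s in a..b, T (x - c - s) * W s) := by
  obtain ⟨α, γ, h⟩ := hT
  refine ⟨fun k => ∫ s in a..b, (α k * Real.cos (k * (c + s)) - γ k * Real.sin (k * (c + s))) * W s,
    fun k => ∫ s in a..b, (α k * Real.sin (k * (c + s)) + γ k * Real.cos (k * (c + s))) * W s, fun x => ?_⟩
  have i1 : ∀ k : ℕ, IntervalIntegrable (fun s => (α k * Real.cos (k * (c + s)) - γ k * Real.sin (k * (c + s))) * W s) volume a b :=
    fun k => hW.continuousOn_mul (by fun_prop)
  have i2 : ∀ k : ℕ, IntervalIntegrable (fun s => (α k * Real.sin (k * (c + s)) + γ k * Real.cos (k * (c + s))) * W s) volume a b :=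
    fun k => hW.continuousOn_mul (by fun_prop)
  have e : ∀ s, T (x - c - s) * W s = ∑ k ∈ Finset.range n,
      (((α k * Real.cos (k * (c + s)) - γ k * Real.sin (k * (c + s))) * W s) * Real.cos (k * x) +
      ((α k * Real.sin (k * (c + s)) + γ k * Real.cos (k * (c + s))) * W s) * Real.sin (k * x)) := by
    intro s
    rw [h, Finset.sum_mul]
    refine Finset.sum_congr rfl fun k _ => ?_
    have : (k:ℝ) * (x - c - s) = k * x - k * (c + s) := by ring
    rw [this, Real.cos_sub, Real.sin_sub]; ring
  simp_rw [e]
  rw [intervalIntegral.integral_finsetSum]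
  · refine Finset.sum_congr rfl fun k _ => ?_
    rw [intervalIntegral.integral_add ((i1 k).mul_const _) ((i2 k).mul_const _),
      intervalIntegral.integral_mul_const, intervalIntegral.integral_mul_const]
  · intro k _
    exact ((i1 k).mul_const _).add ((i2 k).mul_const _)

lemma conv_swap {g T : ℝ → ℝ} (hg : Function.Periodic g (2 * π)) (hT : Function.Periodic T (2 * π)) (x : ℝ) :
    ∫ t in (-π)..π, g (x - t) * T t = ∫ t in (-π)..π, T (x - t) * g t := by
  set F : ℝ → ℝ := fun t => T (x - t) * g t with hF
  have hper : Function.Periodic F (2 * π) := by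
    intro t
    simp only [hF]
    rw [hg t, show x - (t + 2 * π) = (x - t) - 2 * π by ring, hT.sub_eq]
  have e : (fun t => g (x - t) * T t) = fun t => F (x - t) := by
    funext t; simp only [hF]; rw [sub_sub_cancel]; ring
  rw [e, intervalIntegral.integral_comp_sub_left]
  have := hper.intervalIntegral_add_eq (x - π) (-π)
  rw [show x - π + 2 * π = x - -π by ring, show -π + 2 * π = π by ring] at this
  exact this

/-- Dirichlet-type sum -/
def DD (m : ℕ) (t : ℝ) : ℂ := ∑ l ∈ Finset.range m, Complex.exp (((l * t : ℝ) : ℂ) * Complex.I)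

/-- its square modulus -/
def GG (m : ℕ) (t : ℝ) : ℝ := ‖DD m t‖ ^ 2

lemma DD_cont (m : ℕ) : Continuous (DD m) := by
  unfold DD; fun_prop

lemma GG_cont (m : ℕ) : Continuous (GG m) := by
  unfold GG; exact (DD_cont m).norm.pow 2

lemma normSq_exp_sum (m : ℕ) (z : ℕ → ℂ) (t : ℝ) :
    ((‖∑ l ∈ Finset.range m, z l * Complex.exp (((l * t : ℝ) : ℂ) * Complex.I)‖ ^ 2 : ℝ) : ℂ) =
    ∑ l ∈ Finset.range m, ∑ k ∈ Finset.range m,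
      z l * (starRingEnd ℂ) (z k) * Complex.exp (((((l:ℤ) - (k:ℤ) : ℤ) : ℂ) * Complex.I) * t) := by
  rw [← Complex.normSq_eq_norm_sq, ← Complex.mul_conj, map_sum, Finset.sum_mul_sum]
  refine Finset.sum_congr rfl fun l _ => Finset.sum_congr rfl fun k _ => ?_
  rw [map_mul, ← Complex.exp_conj]
  simp only [map_mul, Complex.conj_I, Complex.conj_ofReal]
  rw [mul_mul_mul_comm, ← Complex.exp_add]
  congr 2
  push_cast; ring

lemma parseval_fin (m : ℕ) (z : ℕ → ℂ) :
    ∫ t in (0:ℝ)..(2 * π), ‖∑ l ∈ Finset.range m, z l * Complex.exp (((l * t : ℝ) : ℂ) * Complex.I)‖ ^ 2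
      = 2 * π * ∑ l ∈ Finset.range m, ‖z l‖ ^ 2 := by
  have : ((∫ t in (0:ℝ)..(2 * π), ‖∑ l ∈ Finset.range m, z l * Complex.exp (((l * t : ℝ) : ℂ) * Complex.I)‖ ^ 2 : ℝ) : ℂ)
      = ((2 * π * ∑ l ∈ Finset.range m, ‖z l‖ ^ 2 : ℝ) : ℂ) := by
    rw [← intervalIntegral.integral_ofReal]
    simp_rw [normSq_exp_sum]
    have horth : ∀ l k : ℕ, ∫ t in (0:ℝ)..(2 * π), Complex.exp (((((l:ℤ) - (k:ℤ) : ℤ) : ℂ) * Complex.I) * t)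
        = if l = k then 2 * π else 0 := by
      intro l k
      split_ifs with h
      · subst h; simp
      · have hz : ((l:ℤ) - (k:ℤ)) ≠ 0 := by omega
        rw [integral_exp_mul_complex (by simp only [ne_eq, mul_eq_zero, Complex.I_ne_zero, or_false]; exact_mod_cast hz)]
        have : Complex.exp (((((l:ℤ) - (k:ℤ) : ℤ) : ℂ) * Complex.I) * ((2 * π : ℝ) : ℂ)) = 1 := by
          rw [Complex.exp_eq_one_iff]
          exact ⟨(l:ℤ) - k, by push_cast; ring⟩
        rw [this]; simp
    rw [intervalIntegral.integral_finsetSum (fun l _ => by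
      apply Continuous.intervalIntegrable; fun_prop)]
    rw [Complex.ofReal_mul, Complex.ofReal_sum, Finset.mul_sum]
    refine Finset.sum_congr rfl fun l hl => ?_
    rw [intervalIntegral.integral_finsetSum (fun k _ => by
      apply Continuous.intervalIntegrable; fun_prop)]
    simp only [intervalIntegral.integral_const_mul, horth]
    rw [Finset.sum_eq_single_of_mem l hl (fun k _ hk => by simp [Ne.symm hk]), if_pos rfl]
    rw [Complex.mul_conj, Complex.normSq_eq_norm_sq]; push_cast; ring
  exact_mod_cast this

lemma GG_expand (m : ℕ) (t : ℝ) : GG m t =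
    ∑ l ∈ Finset.range m, ∑ k ∈ Finset.range m, Real.cos (((l:ℤ) - (k:ℤ) : ℤ) * t) := by
  have := normSq_exp_sum m (fun _ => 1) t
  have h2 := congrArg Complex.re this
  rw [Complex.ofReal_re] at h2
  simp only [one_mul, map_one] at h2
  unfold GG DD
  rw [h2, Complex.re_sum]
  refine Finset.sum_congr rfl fun l _ => ?_
  rw [Complex.re_sum]
  refine Finset.sum_congr rfl fun k _ => ?_
  have : (((((l:ℤ) - (k:ℤ) : ℤ) : ℂ) * Complex.I) * t) = (((((l:ℤ) - (k:ℤ) : ℤ) : ℝ) * t : ℝ) : ℂ) * Complex.I := by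
    push_cast; ring
  rw [this, Complex.exp_ofReal_mul_I_re]

lemma DD_norm_le (m : ℕ) (t : ℝ) : ‖DD m t‖ ≤ m := by
  unfold DD
  refine (norm_sum_le _ _).trans ?_
  simp only [Complex.norm_exp_ofReal_mul_I]; simp

lemma GG_nonneg (m : ℕ) (t : ℝ) : 0 ≤ GG m t := by unfold GG; positivity

lemma GG_le (m : ℕ) (t : ℝ) : GG m t ≤ (m:ℝ) ^ 2 := by
  unfold GG; gcongr; exact DD_norm_le m t

lemma norm_exp_sub_one_ge {t : ℝ} (ht : |t| ≤ π) : 2 / π * |t| ≤ ‖Complex.exp ((t : ℂ) * Complex.I) - 1‖ := by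
  rw [mul_comm (t:ℂ), Complex.norm_exp_I_mul_ofReal_sub_one, norm_mul, Real.norm_eq_abs, Real.norm_eq_abs, abs_two]
  have h := Real.mul_abs_le_abs_sin (x := t / 2) (by rw [abs_div, abs_two]; linarith)
  rw [abs_div, abs_two] at h
  linarith

lemma GG_decay (m : ℕ) {t : ℝ} (ht : |t| ≤ π) : GG m t * t ^ 2 ≤ π ^ 2 := by
  have h1 : DD m t * (Complex.exp ((t : ℂ) * Complex.I) - 1) = Complex.exp (((m * t : ℝ) : ℂ) * Complex.I) - 1 := by
    have e : DD m t = ∑ l ∈ Finset.range m, (Complex.exp ((t : ℂ) * Complex.I)) ^ l := by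
      unfold DD
      refine Finset.sum_congr rfl fun l _ => ?_
      rw [← Complex.exp_nat_mul]; congr 1; push_cast; ring
    rw [e, geom_sum_mul, ← Complex.exp_nat_mul]; congr 2; push_cast; ring
  have h2 : ‖DD m t‖ * ‖Complex.exp ((t : ℂ) * Complex.I) - 1‖ ≤ 2 := by
    rw [← norm_mul, h1]
    refine (norm_sub_le _ _).trans ?_
    rw [Complex.norm_exp_ofReal_mul_I]; norm_num
  have h3 := norm_exp_sub_one_ge ht
  have h4 : ‖DD m t‖ * (2 / π * |t|) ≤ 2 := (mul_le_mul_of_nonneg_left h3 (norm_nonneg _)).trans h2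
  have h5 : ‖DD m t‖ * |t| ≤ π := by
    have : ‖DD m t‖ * (2 / π * |t|) = 2 / π * (‖DD m t‖ * |t|) := by ring
    rw [this, div_mul_eq_mul_div, div_le_iff₀ Real.pi_pos] at h4
    linarith
  have : GG m t * t ^ 2 = (‖DD m t‖ * |t|) ^ 2 := by unfold GG; rw [mul_pow, sq_abs]
  rw [this]; gcongr

lemma GG_lower (m : ℕ) {t : ℝ} (ht : m * |t| ≤ 1) : (m:ℝ) ^ 2 / 4 ≤ GG m t := by
  have h1 : (m:ℝ) / 2 ≤ (DD m t).re := by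
    unfold DD
    rw [Complex.re_sum]
    simp_rw [Complex.exp_ofReal_mul_I_re]
    have : ∑ l ∈ Finset.range m, (1/2:ℝ) ≤ ∑ l ∈ Finset.range m, Real.cos (l * t) := by
      refine Finset.sum_le_sum fun l hl => ?_
      have hl' : (l:ℝ) ≤ m := by exact_mod_cast (Finset.mem_range.1 hl).le
      have h1 : |(l:ℝ) * t| ≤ 1 := by
        rw [abs_mul, Nat.abs_cast]
        exact (mul_le_mul_of_nonneg_right hl' (abs_nonneg _)).trans ht
      have := Real.one_sub_sq_div_two_le_cos (x := (l:ℝ) * t)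
      have h2 : ((l:ℝ) * t) ^ 2 ≤ 1 := by rw [← sq_abs]; nlinarith [abs_nonneg ((l:ℝ) * t)]
      linarith
    simp at this
    linarith
  have h2 := (le_abs_self _).trans (Complex.abs_re_le_norm (DD m t))
  unfold GG
  have h0 : (0:ℝ) ≤ m := by positivity
  nlinarith

lemma GG_succ (m : ℕ) (t : ℝ) :
    GG (m + 1) t - GG m t = 1 + 2 * ∑ l ∈ Finset.range m, Real.cos ((l + 1) * t) := by
  have e : ∀ k : ℕ, GG k t = (∑ l ∈ Finset.range k, Real.cos (l * t)) ^ 2 + (∑ l ∈ Finset.range k, Real.sin (l * t)) ^ 2 := by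
    intro k
    unfold GG DD
    rw [← Complex.normSq_eq_norm_sq, Complex.normSq_apply, Complex.re_sum, Complex.im_sum]
    simp_rw [Complex.exp_ofReal_mul_I_re, Complex.exp_ofReal_mul_I_im]
    ring
  rw [e, e, Finset.sum_range_succ, Finset.sum_range_succ]
  have h1 : ∑ l ∈ Finset.range m, Real.cos ((l + 1) * t) = ∑ l ∈ Finset.range m, Real.cos (m * t - l * t) := by
    rw [← Finset.sum_range_reflect]
    refine Finset.sum_congr rfl fun l hl => ?_
    have hl' := Finset.mem_range.1 hl
    rw [Nat.cast_sub (by omega), Nat.cast_sub (by omega)]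
    congr 1; push_cast; ring
  rw [h1]
  simp_rw [Real.cos_sub]
  rw [Finset.sum_add_distrib, ← Finset.mul_sum, ← Finset.mul_sum]
  linear_combination Real.sin_sq_add_cos_sq (m * t)

lemma GG_mod (m : ℕ) (hm : 1 ≤ m) (h : ℝ) :
    ∫ t in (0:ℝ)..(2 * π), |GG m (t + h) - GG m t| ≤ 4 * π * |h| * (m * (m - 1)) := by
  rcases Nat.eq_or_lt_of_le hm with h1 | h1
  · subst h1
    have : ∀ t, GG 1 t = 1 := by intro t; simp [GG, DD]
    simp [this]
  by_cases hh : h = 0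
  · subst hh; simp
  have hh' : 0 < |h| := abs_pos.2 hh
  have hm1 : (0:ℝ) < m - 1 := by
    have : (1:ℝ) < m := by exact_mod_cast h1
    linarith
  have hshift : ∀ t, DD m (t + h) = ∑ l ∈ Finset.range m, Complex.exp (((l * h : ℝ) : ℂ) * Complex.I) * Complex.exp (((l * t : ℝ) : ℂ) * Complex.I) := by
    intro t; unfold DD
    refine Finset.sum_congr rfl fun l _ => ?_
    rw [← Complex.exp_add]; congr 1; push_cast; ring
  have p0 : ∫ t in (0:ℝ)..(2 * π), ‖DD m t‖ ^ 2 = 2 * π * m := by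
    have := parseval_fin m (fun _ => 1)
    simp only [one_mul] at this
    unfold DD; rw [this]; simp
  have p1 : ∫ t in (0:ℝ)..(2 * π), ‖DD m (t + h)‖ ^ 2 = 2 * π * m := by
    simp_rw [hshift]
    rw [parseval_fin]; simp only [Complex.norm_exp_ofReal_mul_I]; simp
  have p2 : ∫ t in (0:ℝ)..(2 * π), ‖DD m (t + h) - DD m t‖ ^ 2 ≤ 2 * π * (m * ((m - 1) * |h|) ^ 2) := by
    have e : ∀ t, DD m (t + h) - DD m t = ∑ l ∈ Finset.range m, (Complex.exp (((l * h : ℝ) : ℂ) * Complex.I) - 1) * Complex.exp (((l * t : ℝ) : ℂ) * Complex.I) := by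
      intro t; rw [hshift]; unfold DD; rw [← Finset.sum_sub_distrib]
      exact Finset.sum_congr rfl fun l _ => by ring
    simp_rw [e]
    rw [parseval_fin]
    gcongr
    have : ∑ l ∈ Finset.range m, ‖Complex.exp (((l * h : ℝ) : ℂ) * Complex.I) - 1‖ ^ 2 ≤ ∑ l ∈ Finset.range m, (((m:ℝ) - 1) * |h|) ^ 2 := by
      refine Finset.sum_le_sum fun l hl => ?_
      have hl' : (l:ℝ) ≤ m - 1 := by
        have := Finset.mem_range.1 hl
        have : (l:ℝ) + 1 ≤ m := by exact_mod_cast this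
        linarith
      have h2 : ‖Complex.exp (((l * h : ℝ) : ℂ) * Complex.I) - 1‖ ≤ |(l:ℝ) * h| := by
        rw [mul_comm _ Complex.I]
        have := Real.norm_exp_I_mul_ofReal_sub_one_le (x := (l:ℝ) * h)
        simpa using this
      rw [abs_mul, Nat.abs_cast] at h2
      gcongr
      exact h2.trans (mul_le_mul_of_nonneg_right hl' hh'.le)
    simpa using this
  have hD := DD_cont m
  have hDs : Continuous (fun t => DD m (t + h)) := by fun_prop
  have hG := GG_cont m
  have pw : ∀ t, |GG m (t + h) - GG m t| ≤ (1 / (|h| * (m - 1))) * ‖DD m (t + h) - DD m t‖ ^ 2 +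
      (|h| * (m - 1)) / 2 * (‖DD m (t + h)‖ ^ 2 + ‖DD m t‖ ^ 2) := by
    intro t
    unfold GG
    have a1 := abs_norm_sub_norm_le (DD m (t + h)) (DD m t)
    set u := ‖DD m (t + h)‖
    set v := ‖DD m t‖
    set w := ‖DD m (t + h) - DD m t‖
    have hu : 0 ≤ u := norm_nonneg _
    have hv : 0 ≤ v := norm_nonneg _
    have hw : 0 ≤ w := norm_nonneg _
    set q := |h| * ((m:ℝ) - 1) with hq
    have hqp : 0 < q := by positivity
    have e : |u ^ 2 - v ^ 2| = |u - v| * (u + v) := by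
      rw [sq_sub_sq, abs_mul, abs_of_nonneg (by positivity : 0 ≤ u + v)]; ring
    rw [e]
    have s1 : |u - v| * (u + v) ≤ w * (u + v) := by gcongr
    have s2 : w * (u + v) ≤ 1 / q * w ^ 2 + q / 4 * (u + v) ^ 2 := by
      have : 1 / q * w ^ 2 + q / 4 * (u + v) ^ 2 - w * (u + v) = (1/q) * (w - q / 2 * (u + v)) ^ 2 := by
        field_simp; ring
      have : 0 ≤ (1/q) * (w - q / 2 * (u + v)) ^ 2 := by positivity
      linarith
    have s3 : q / 4 * (u + v) ^ 2 ≤ q / 2 * (u ^ 2 + v ^ 2) := by nlinarith [sq_nonneg (u - v)]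
    linarith
  have i1 : IntervalIntegrable (fun t => ‖DD m (t + h) - DD m t‖ ^ 2) volume 0 (2 * π) :=
    Continuous.intervalIntegrable (by fun_prop) _ _
  have i2 : IntervalIntegrable (fun t => ‖DD m (t + h)‖ ^ 2) volume 0 (2 * π) :=
    Continuous.intervalIntegrable (by fun_prop) _ _
  have i3 : IntervalIntegrable (fun t => ‖DD m t‖ ^ 2) volume 0 (2 * π) :=
    Continuous.intervalIntegrable (by fun_prop) _ _
  have hint := intervalIntegral.integral_mono_on (μ := volume) (a := 0) (b := 2 * π) (by positivity)
    (Continuous.intervalIntegrable (by fun_prop) _ _) ((i1.const_mul _).add ((i2.add i3).const_mul _)) (fun t _ => pw t)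
  refine hint.trans ?_
  rw [intervalIntegral.integral_add (i1.const_mul _) ((i2.add i3).const_mul _), intervalIntegral.integral_const_mul,
    intervalIntegral.integral_const_mul, intervalIntegral.integral_add i2 i3, p0, p1]
  have : 1 / (|h| * ((m:ℝ) - 1)) * ∫ t in (0:ℝ)..(2 * π), ‖DD m (t + h) - DD m t‖ ^ 2 ≤
      1 / (|h| * ((m:ℝ) - 1)) * (2 * π * (m * ((m - 1) * |h|) ^ 2)) := by gcongr
  have e : 1 / (|h| * ((m:ℝ) - 1)) * (2 * π * (m * ((m - 1) * |h|) ^ 2)) = 2 * π * |h| * (m * (m - 1)) := by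
    field_simp
  rw [e] at this
  linarith


lemma tp_GG_sq (m n : ℕ) (h : 2 * m ≤ n + 1) (hm : 1 ≤ m) : IsTrigPoly n (fun t => (GG m t) ^ 2) := by
  have e : (fun t => (GG m t) ^ 2) = fun t => ∑ l ∈ Finset.range m, ∑ k ∈ Finset.range m,
      ∑ l' ∈ Finset.range m, ∑ k' ∈ Finset.range m,
      ((1/2) * Real.cos ((((l:ℤ) - k - (l' - k') : ℤ) : ℝ) * t + 0) + (1/2) * Real.cos ((((l:ℤ) - k + (l' - k') : ℤ) : ℝ) * t + 0)) := by
    funext t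
    rw [sq, GG_expand, Finset.sum_mul]
    refine Finset.sum_congr rfl fun l _ => ?_
    rw [Finset.sum_mul]
    refine Finset.sum_congr rfl fun k _ => ?_
    rw [Finset.mul_sum]
    refine Finset.sum_congr rfl fun l' _ => ?_
    rw [Finset.mul_sum]
    refine Finset.sum_congr rfl fun k' _ => ?_
    have h := Real.two_mul_cos_mul_cos ((((l:ℤ) - k : ℤ) : ℝ) * t) ((((l':ℤ) - k' : ℤ) : ℝ) * t)
    rw [← sub_mul, ← add_mul, ← Int.cast_sub, ← Int.cast_add] at h
    rw [add_zero, add_zero]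
    linarith
  rw [e]
  refine tp_sum _ _ fun l hl => tp_sum _ _ fun k hk => tp_sum _ _ fun l' hl' => tp_sum _ _ fun k' hk' => ?_
  rw [Finset.mem_range] at hl hk hl' hk'
  exact tp_add (tp_smul _ (tp_cos _ (by omega) _)) (tp_smul _ (tp_cos _ (by omega) _))

lemma jackson : ∃ C : ℝ, 0 < C ∧ ∀ n : ℕ, 1 ≤ n → ∃ J : ℝ → ℝ, IsTrigPoly n J ∧
    ∫ t in (-π)..π, J t = 1 ∧ ∫ t in (-π)..π, |J t| * (1 + n * |t|) ≤ C := by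
  refine ⟨16 * π * (1 + π ^ 2) ^ 2, by positivity, fun n hn => ?_⟩
  obtain ⟨m, hm1, hm2, hm3⟩ : ∃ m : ℕ, 1 ≤ m ∧ 2 * m ≤ n + 1 ∧ n ≤ 2 * m := ⟨(n + 1) / 2, by omega, by omega, by omega⟩
  have hmR : (1:ℝ) ≤ m := by exact_mod_cast hm1
  have hm0 : (0:ℝ) < m := by linarith
  have hnm : (n:ℝ) ≤ 2 * m := by exact_mod_cast hm3
  have hpi := Real.pi_pos
  have hpi3 := Real.pi_gt_three
  have hGc := GG_cont m
  set Z := ∫ t in (-π)..π, (GG m t) ^ 2 with hZ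
  have hZlow : (m:ℝ) ^ 3 / 8 ≤ Z := by
    have hi : ∀ a b, IntervalIntegrable (fun t => (GG m t) ^ 2) volume a b := fun a b =>
      Continuous.intervalIntegrable (by fun_prop) _ _
    have hm' : 1 / (m:ℝ) ≤ 1 := by rw [div_le_one hm0]; exact hmR
    have hm'' : 0 < 1 / (m:ℝ) := by positivity
    have h1 : ∫ t in (-(1/(m:ℝ)))..(1/m), (GG m t)^2 ≤ Z := by
      rw [hZ]
      apply intervalIntegral.integral_mono_interval (by linarith) (by linarith) (by linarith) _ (hi _ _)
      exact Filter.Eventually.of_forall fun t => by positivity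
    have h2 : ∫ t in (-(1/(m:ℝ)))..(1/m), ((m:ℝ)^4/16) ≤ ∫ t in (-(1/(m:ℝ)))..(1/m), (GG m t)^2 := by
      apply intervalIntegral.integral_mono_on (by linarith) (by simp) (hi _ _)
      intro t ht
      have := GG_lower m (t := t) (by
        have : |t| ≤ 1 / m := abs_le.2 ht
        rw [le_div_iff₀ hm0] at this; linarith)
      have e : (m:ℝ)^4/16 = ((m:ℝ)^2/4)^2 := by ring
      rw [e]; gcongr
    rw [intervalIntegral.integral_const, smul_eq_mul] at h2
    have e : (1 / (m:ℝ) - -(1/m)) * (m^4/16) = m^3/8 := by field_simp; norm_num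
    linarith
  have hZpos : 0 < Z := lt_of_lt_of_le (by positivity) hZlow
  refine ⟨fun t => Z⁻¹ * (GG m t) ^ 2, tp_smul _ (tp_GG_sq m n hm2 hm1), ?_, ?_⟩
  · rw [intervalIntegral.integral_const_mul, ← hZ, inv_mul_cancel₀ hZpos.ne']
  · have e : ∀ t, |Z⁻¹ * (GG m t) ^ 2| * (1 + n * |t|) = Z⁻¹ * ((GG m t) ^ 2 * (1 + n * |t|)) := by
      intro t; rw [abs_of_nonneg (by positivity)]; ring
    simp_rw [e]
    rw [intervalIntegral.integral_const_mul]
    have hup : ∫ t in (-π)..π, (GG m t) ^ 2 * (1 + n * |t|) ≤ ∫ t in (-π)..π, 2 * (1 + π^2)^2 * m^4 * (1 + (m * t)^2)⁻¹ := by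
      apply intervalIntegral.integral_mono_on (by linarith)
      · exact Continuous.intervalIntegrable (by fun_prop) _ _
      · apply Continuous.intervalIntegrable
        have : ∀ t : ℝ, 1 + (m * t)^2 ≠ 0 := fun t => by positivity
        fun_prop (disch := assumption)
      · intro t ht
        have ht' : |t| ≤ π := abs_le.2 ht
        have a1 : GG m t * (1 + (m*t)^2) ≤ (1 + π^2) * m^2 := by
          have := GG_le m t
          have := GG_decay m ht'
          nlinarith
        have a2 : 1 + n * |t| ≤ 2 * (1 + (m * t)^2) := by
          have : n * |t| ≤ 2 * m * |t| := by gcongr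
          have e : (m * t)^2 = (m * |t|)^2 := by rw [mul_pow, mul_pow, sq_abs]
          rw [e]
          nlinarith [sq_nonneg (m * |t| - 1)]
        have hq : 0 < 1 + (m*t)^2 := by positivity
        rw [← div_eq_mul_inv, le_div_iff₀ hq]
        have hG0 := GG_nonneg m t
        calc (GG m t) ^ 2 * (1 + n * |t|) * (1 + (m*t)^2) ≤ (GG m t) ^ 2 * (2 * (1 + (m * t)^2)) * (1 + (m*t)^2) := by gcongr
          _ = 2 * (GG m t * (1 + (m*t)^2)) ^ 2 := by ring
          _ ≤ 2 * ((1 + π^2) * m^2) ^ 2 := by gcongr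
          _ = _ := by ring
    have hat : ∫ t in (-π)..π, (1 + (m * t)^2)⁻¹ ≤ π / m := by
      have := intervalIntegral.integral_comp_mul_left (a := -π) (b := π) (fun u : ℝ => (1 + u^2)⁻¹) hm0.ne'
      rw [this, integral_inv_one_add_sq, smul_eq_mul]
      have h1 := Real.arctan_lt_pi_div_two (m * π)
      have h2 := Real.neg_pi_div_two_lt_arctan (m * -π)
      rw [div_eq_inv_mul]; gcongr; linarith
    rw [intervalIntegral.integral_const_mul] at hup
    have hfin : ∫ t in (-π)..π, (GG m t) ^ 2 * (1 + n * |t|) ≤ 2 * π * (1 + π^2)^2 * m^3 := by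
      refine hup.trans ?_
      calc _ ≤ 2 * (1 + π^2)^2 * m^4 * (π / m) := by gcongr
        _ = _ := by field_simp
    rw [inv_mul_le_iff₀ hZpos]
    refine hfin.trans ?_
    have : 16 * π * (1 + π^2)^2 * (m^3/8) ≤ 16 * π * (1 + π^2)^2 * Z := by gcongr
    linarith


def ee (l : ℕ) (t : ℝ) : ℝ := if l = 0 then 1 else 2 * Real.cos (l * t)

lemma ee_abs (l : ℕ) (t : ℝ) : |ee l t| ≤ 2 := by
  unfold ee; split_ifs
  · norm_num
  · rw [abs_mul, abs_two]; linarith [Real.abs_cos_le_one (l * t)]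

lemma ee_cont (l : ℕ) : Continuous (ee l) := by
  unfold ee; split_ifs <;> fun_prop

lemma ee_per (l : ℕ) (t : ℝ) : ee l (t + 2 * π) = ee l t := by
  unfold ee; split_ifs
  · rfl
  · rw [mul_add, Real.cos_add_nat_mul_two_pi]

def DN (M : ℕ) (t : ℝ) : ℝ := ∑ l ∈ Finset.range M, ee l t

lemma DN_abs (M : ℕ) (t : ℝ) : |DN M t| ≤ 2 * M := by
  unfold DN
  refine (Finset.abs_sum_le_sum_abs _ _).trans ((Finset.sum_le_sum fun l _ => ee_abs l t).trans ?_)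
  simp; linarith

lemma GG_succ' (m : ℕ) (t : ℝ) : GG (m + 1) t = GG m t + DN (m + 1) t := by
  have := GG_succ m t
  have e : DN (m+1) t = 1 + 2 * ∑ l ∈ Finset.range m, Real.cos ((l + 1) * t) := by
    unfold DN
    rw [Finset.sum_range_succ', Finset.mul_sum]
    simp [ee]; ring
  linarith

lemma abel2 (a E D G : ℕ → ℝ) (hD0 : D 0 = 0) (hD : ∀ M, D (M+1) = D M + E M)
    (hG0 : G 0 = 0) (hG : ∀ M, G (M+1) = G M + D (M+1)) (M : ℕ) :
    ∑ l ∈ Finset.range M, a l * E l = ∑ j ∈ Finset.range M, (a j - 2 * a (j+1) + a (j+2)) * G (j+1)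
      + (a M - a (M+1)) * G M + a M * D M := by
  induction M with
  | zero => simp [hD0, hG0]
  | succ M ih =>
    rw [Finset.sum_range_succ, Finset.sum_range_succ, ih, hG M, hD M]
    ring

/-- hypotheses on coefficient sequences -/
structure GoodSeq (a : ℕ → ℝ) : Prop where
  nonneg : ∀ j, 0 ≤ a j
  anti : Antitone a
  conv : ∀ j, 0 ≤ a j - 2 * a (j+1) + a (j+2)
  summ : Summable a

lemma GoodSeq.tend {a : ℕ → ℝ} (h : GoodSeq a) : Tendsto (fun M : ℕ => (M:ℝ) * a M) atTop (nhds 0) := by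
  have ht : Tendsto (fun M : ℕ => ∑' k, a (k + M)) atTop (nhds 0) := tendsto_sum_nat_add a
  have ht2 : Tendsto (fun M : ℕ => 2 * ∑' k, a (k + M / 2)) atTop (nhds 0) := by
    have h1 := (ht.comp (Nat.tendsto_div_const_atTop (n := 2) (by norm_num))).const_mul 2
    simpa using h1
  refine squeeze_zero (fun M => mul_nonneg (by positivity) (h.nonneg M)) (fun M => ?_) ht2
  have h1 : ∑ k ∈ Finset.range (M - M/2), a (k + M/2) ≤ ∑' k, a (k + M/2) :=
    ((summable_nat_add_iff (M/2)).2 h.summ).sum_le_tsum _ (fun k _ => h.nonneg _)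
  have h2 : ∑ k ∈ Finset.range (M - M/2), a M ≤ ∑ k ∈ Finset.range (M - M/2), a (k + M/2) := by
    refine Finset.sum_le_sum fun k hk => h.anti ?_
    have := Finset.mem_range.1 hk
    omega
  rw [Finset.sum_const, Finset.card_range, nsmul_eq_mul] at h2
  have h3 : (M:ℝ) ≤ 2 * ((M - M/2 : ℕ) : ℝ) := by
    have : M ≤ 2 * (M - M/2) := by omega
    exact_mod_cast this
  have := h.nonneg M
  nlinarith

def PP (a : ℕ → ℝ) (t : ℝ) : ℝ := ∑' l, a l * ee l t

def UU (a : ℕ → ℝ) (M : ℕ) (t : ℝ) : ℝ := ∑ l ∈ Finset.range M, a l * ee l t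

lemma UU_cont (a : ℕ → ℝ) (M : ℕ) : Continuous (UU a M) := by
  unfold UU
  exact continuous_finset_sum _ fun l _ => continuous_const.mul (ee_cont l)

lemma UU_eq (a : ℕ → ℝ) (M : ℕ) (t : ℝ) :
    UU a M t = ∑ j ∈ Finset.range M, (a j - 2 * a (j+1) + a (j+2)) * GG (j+1) t
      + (a M - a (M+1)) * GG M t + a M * DN M t :=
  abel2 a (fun l => ee l t) (fun M => DN M t) (fun M => GG M t) (by simp [DN])
    (fun M => by simp [DN, Finset.sum_range_succ]) (by simp [GG, DD]) (fun M => GG_succ' M t) M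

section
variable {a : ℕ → ℝ}

lemma term_le (h : GoodSeq a) (l : ℕ) (t : ℝ) : ‖a l * ee l t‖ ≤ 2 * a l := by
  rw [norm_mul, Real.norm_eq_abs, Real.norm_eq_abs, abs_of_nonneg (h.nonneg l)]
  nlinarith [ee_abs l t, h.nonneg l]

lemma PP_summable (h : GoodSeq a) (t : ℝ) : Summable (fun l => a l * ee l t) :=
  Summable.of_norm_bounded (h.summ.mul_left 2) (fun l => term_le h l t)

lemma PP_cont (h : GoodSeq a) : Continuous (PP a) :=
  continuous_tsum (fun l => continuous_const.mul (ee_cont l)) (h.summ.mul_left 2) (fun l t => term_le h l t)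

lemma PP_per (t : ℝ) : PP a (t + 2 * π) = PP a t := by
  unfold PP; simp_rw [ee_per]

lemma PP_sub_UU (h : GoodSeq a) (M : ℕ) (t : ℝ) : |PP a t - UU a M t| ≤ 2 * ∑' k, a (k + M) := by
  have h1 := (PP_summable h t).sum_add_tsum_nat_add M
  have e : PP a t - UU a M t = ∑' k, a (k + M) * ee (k + M) t := by unfold PP UU; linarith
  rw [e, ← tsum_mul_left]
  exact tsum_of_norm_bounded (((summable_nat_add_iff M).2 h.summ).mul_left 2).hasSum (fun l => term_le h _ t)

lemma PP_nonneg (h : GoodSeq a) (t : ℝ) : 0 ≤ PP a t := by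
  have h1 : Tendsto (fun M => UU a M t) atTop (nhds (PP a t)) := (PP_summable h t).hasSum.tendsto_sum_nat
  have h2 : Tendsto (fun M : ℕ => -2 * ((M:ℝ) * a M)) atTop (nhds 0) := by
    simpa using h.tend.const_mul (-2)
  refine le_of_tendsto_of_tendsto' h2 h1 fun M => ?_
  rw [UU_eq]
  have s1 : 0 ≤ ∑ j ∈ Finset.range M, (a j - 2 * a (j+1) + a (j+2)) * GG (j+1) t :=
    Finset.sum_nonneg fun j _ => mul_nonneg (h.conv j) (GG_nonneg _ _)
  have s2 : 0 ≤ (a M - a (M+1)) * GG M t :=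
    mul_nonneg (by have := h.anti (Nat.le_succ M); simp at this; linarith) (GG_nonneg _ _)
  have s3 := (abs_le.1 (DN_abs M t)).1
  nlinarith [h.nonneg M]

lemma PP_integral (h : GoodSeq a) (c : ℝ) : ∫ t in (0:ℝ)..(2 * π), PP a (c + t) = 2 * π * a 0 := by
  have e : ∫ t in (0:ℝ)..(2 * π), PP a (c + t) = ∫ t in (0:ℝ)..(2 * π), PP a t := by
    rw [intervalIntegral.integral_comp_add_left (fun t => PP a t)]
    have hp : Function.Periodic (PP a) (2 * π) := fun t => PP_per t
    have := hp.intervalIntegral_add_eq c 0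
    simpa using this
  rw [e]
  have hs := intervalIntegral.hasSum_integral_of_dominated_convergence (μ := volume) (a := 0) (b := 2 * π)
    (F := fun l t => a l * ee l t) (f := PP a) (fun l _ => 2 * a l)
    (fun l => (continuous_const.mul (ee_cont l)).aestronglyMeasurable)
    (fun l => Eventually.of_forall fun t _ => term_le h l t)
    (Eventually.of_forall fun t _ => h.summ.mul_left 2)
    (by simp)
    (Eventually.of_forall fun t _ => (PP_summable h t).hasSum)
  refine hs.unique ?_
  have : ∀ l, ∫ t in (0:ℝ)..(2 * π), a l * ee l t = if l = 0 then 2 * π * a 0 else 0 := by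
    intro l
    rw [intervalIntegral.integral_const_mul]
    split_ifs with hl
    · subst hl; simp [ee]; ring
    · have hl' : (l:ℝ) ≠ 0 := by exact_mod_cast hl
      simp only [ee, hl, if_false]
      rw [intervalIntegral.integral_const_mul, intervalIntegral.integral_comp_mul_left _ hl', integral_cos]
      have := Real.sin_nat_mul_pi (2 * l)
      rw [show (l:ℝ) * (2 * π) = ((2 * l : ℕ) : ℝ) * π by push_cast; ring, this]; simp
  simp_rw [this]
  exact hasSum_ite_eq 0 (2 * π * a 0)

lemma UU_mod (h : GoodSeq a) (M : ℕ) (s : ℝ) :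
    ∫ t in (0:ℝ)..(2 * π), |UU a M (t + s) - UU a M t| ≤
      8 * π * |s| * (∑' j, a (j + 1)) + 8 * π * ((M:ℝ) * a M) := by
  have hpi := Real.pi_pos
  have b0 : ∀ j, 0 ≤ a j - a (j+1) := fun j => by have := h.anti (Nat.le_succ j); simp at this; linarith
  have hGc := GG_cont
  have iG : ∀ m, IntervalIntegrable (fun t => |GG m (t + s) - GG m t|) volume 0 (2*π) := fun m =>
    Continuous.intervalIntegrable (by have := hGc m; fun_prop) _ _
  have hUc := UU_cont a M
  have pw : ∀ t, |UU a M (t + s) - UU a M t| ≤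
      (∑ j ∈ Finset.range M, (a j - 2 * a (j+1) + a (j+2)) * |GG (j+1) (t+s) - GG (j+1) t|
      + (a M - a (M+1)) * |GG M (t+s) - GG M t|) + 4 * ((M:ℝ) * a M) := by
    intro t
    rw [UU_eq, UU_eq]
    have e : ∀ (A B C A' B' C' : ℝ), A + B + C - (A' + B' + C') = (A - A') + (B - B') + (C - C') := by intros; ring
    rw [e, ← Finset.sum_sub_distrib]
    simp_rw [← mul_sub]
    refine (abs_add_three _ _ _).trans ?_
    gcongr ?_ + ?_ + ?_
    · refine (Finset.abs_sum_le_sum_abs _ _).trans (le_of_eq ?_)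
      exact Finset.sum_congr rfl fun j _ => by rw [abs_mul, abs_of_nonneg (h.conv j)]
    · rw [abs_mul, abs_of_nonneg (b0 M)]
    · rw [abs_mul, abs_of_nonneg (h.nonneg M)]
      have h1 := DN_abs M (t+s)
      have h2 := DN_abs M t
      have h3 := abs_sub (DN M (t+s)) (DN M t)
      nlinarith [h.nonneg M]
  have iS : IntervalIntegrable (fun t => ∑ j ∈ Finset.range M, (a j - 2 * a (j+1) + a (j+2)) * |GG (j+1) (t+s) - GG (j+1) t|) volume 0 (2*π) := by
    apply Continuous.intervalIntegrable
    exact continuous_finset_sum _ fun j _ => by have := hGc (j+1); fun_prop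
  have hint := intervalIntegral.integral_mono_on (μ := volume) (a := 0) (b := 2 * π) (by positivity)
    (Continuous.intervalIntegrable (by fun_prop) _ _)
    ((iS.add ((iG M).const_mul _)).add (by simp)) (fun t _ => pw t)
  refine hint.trans ?_
  rw [intervalIntegral.integral_add (iS.add ((iG M).const_mul _)) (by simp), intervalIntegral.integral_add iS ((iG M).const_mul _),
    intervalIntegral.integral_finsetSum (fun j _ => (iG _).const_mul _)]
  simp_rw [intervalIntegral.integral_const_mul]
  rw [intervalIntegral.integral_const, smul_eq_mul]
  have k1 : ∑ j ∈ Finset.range M, (a j - 2 * a (j+1) + a (j+2)) * ∫ t in (0:ℝ)..(2 * π), |GG (j+1) (t+s) - GG (j+1) t|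
      ≤ 4 * π * |s| * ∑ j ∈ Finset.range M, (a j - 2 * a (j+1) + a (j+2)) * (((j+1:ℕ):ℝ) * (((j+1:ℕ):ℝ) - 1)) := by
    rw [Finset.mul_sum]
    refine Finset.sum_le_sum fun j _ => ?_
    have := mul_le_mul_of_nonneg_left (GG_mod (j+1) (by omega) s) (h.conv j)
    linarith
  have k2 : (a M - a (M+1)) * ∫ t in (0:ℝ)..(2 * π), |GG M (t+s) - GG M t| ≤ 4 * π * |s| * ((a M - a (M+1)) * ((M:ℝ) * (M - 1))) := by
    rcases Nat.eq_zero_or_pos M with hM | hM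
    · subst hM
      have : ∀ t, GG 0 t = 0 := fun t => by simp [GG, DD]
      simp [this]
    · have := mul_le_mul_of_nonneg_left (GG_mod M hM s) (b0 M)
      linarith
  have k3 := abel2 a (fun l => if l = 0 then 0 else 2) (fun M => ((2 * (M - 1) : ℕ) : ℝ)) (fun M => (M:ℝ) * (M - 1))
    (by simp) (fun M => by
      rcases Nat.eq_zero_or_pos M with hM | hM
      · subst hM; simp
      · obtain ⟨k, rfl⟩ : ∃ k, M = k + 1 := ⟨M - 1, by omega⟩
        simp; ring) (by simp) (fun M => by simp; ring) M
  have k4 : ∑ l ∈ Finset.range M, a l * (if l = 0 then (0:ℝ) else 2) ≤ 2 * ∑' j, a (j + 1) := by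
    rcases Nat.eq_zero_or_pos M with hM | hM
    · subst hM; simp; exact tsum_nonneg fun j => h.nonneg _
    · obtain ⟨k, rfl⟩ : ∃ k, M = k + 1 := ⟨M - 1, by omega⟩
      rw [Finset.sum_range_succ']
      simp only [Nat.succ_ne_zero, if_false, if_true, mul_zero, add_zero]
      rw [← Finset.sum_mul]
      have := ((summable_nat_add_iff 1).2 h.summ).sum_le_tsum (Finset.range k) (fun k _ => h.nonneg _)
      linarith
  have k5 : 0 ≤ a M * ((2 * (M - 1) : ℕ) : ℝ) := mul_nonneg (h.nonneg M) (by positivity)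
  have hs : 0 ≤ 4 * π * |s| := by positivity
  have k6 := mul_le_mul_of_nonneg_left (show ∑ j ∈ Finset.range M, (a j - 2 * a (j+1) + a (j+2)) * (((j+1:ℕ):ℝ) * (((j+1:ℕ):ℝ) - 1)) + (a M - a (M+1)) * ((M:ℝ) * (M - 1)) ≤ 2 * ∑' j, a (j + 1) by linarith) hs
  linarith

lemma PP_mod (h : GoodSeq a) (s : ℝ) :
    ∫ t in (0:ℝ)..(2 * π), |PP a (t + s) - PP a t| ≤ 8 * π * |s| * (∑' j, a (j + 1)) := by
  have hpi := Real.pi_pos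
  have hlim : Tendsto (fun M : ℕ => 8 * π * |s| * (∑' j, a (j + 1)) + 8 * π * ((M:ℝ) * a M) + 2 * π * (4 * ∑' k, a (k + M))) atTop
      (nhds (8 * π * |s| * (∑' j, a (j + 1)) + 8 * π * 0 + 2 * π * (4 * 0))) := by
    refine (tendsto_const_nhds.add (h.tend.const_mul _)).add (((tendsto_sum_nat_add a).const_mul 4).const_mul _)
  rw [mul_zero, mul_zero, mul_zero, add_zero, add_zero] at hlim
  refine ge_of_tendsto' hlim fun M => ?_
  have hPc := PP_cont h
  have hUc := UU_cont a M
  have pw : ∀ t, |PP a (t + s) - PP a t| ≤ |UU a M (t + s) - UU a M t| + 4 * ∑' k, a (k + M) := by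
    intro t
    have h1 := PP_sub_UU h M (t+s)
    have h2 := PP_sub_UU h M t
    have h3 : PP a (t + s) - PP a t = (UU a M (t + s) - UU a M t) + (PP a (t+s) - UU a M (t+s)) - (PP a t - UU a M t) := by ring
    rw [h3]
    have h4 := abs_sub (UU a M (t + s) - UU a M t + (PP a (t+s) - UU a M (t+s))) (PP a t - UU a M t)
    have h5 := abs_add_le (UU a M (t + s) - UU a M t) (PP a (t+s) - UU a M (t+s))
    linarith
  have iU : IntervalIntegrable (fun t => |UU a M (t + s) - UU a M t|) volume 0 (2 * π) := Continuous.intervalIntegrable (by fun_prop) _ _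
  have hint := intervalIntegral.integral_mono_on (μ := volume) (a := 0) (b := 2 * π) (by positivity)
    (Continuous.intervalIntegrable (by fun_prop) _ _)
    (iU.add (by simp)) (fun t _ => pw t)
  rw [intervalIntegral.integral_add iU (by simp), intervalIntegral.integral_const, smul_eq_mul] at hint
  have := UU_mod h M s
  linarith

end


def cellAvg (p : ℝ → ℝ) (δ : ℝ) (t : ℝ) : ℝ := δ⁻¹ * ∫ v in (0:ℝ)..δ, p (⌊t / δ⌋ * δ + v)

lemma cellAvg_meas (p : ℝ → ℝ) (δ : ℝ) : Measurable (cellAvg p δ) := by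
  have : cellAvg p δ = (fun k : ℤ => δ⁻¹ * ∫ v in (0:ℝ)..δ, p (k * δ + v)) ∘ (fun t => ⌊t / δ⌋) := rfl
  rw [this]
  exact (measurable_from_top).comp (Int.measurable_floor.comp (measurable_id.div_const δ))

lemma cellAvg_sub {p : ℝ → ℝ} (hp : Continuous p) {δ : ℝ} (hδ : 0 < δ) (t : ℝ) :
    |p t - cellAvg p δ t| ≤ δ⁻¹ * ∫ h in (-δ)..δ, |p (t + h) - p t| := by
  set k : ℝ := (⌊t / δ⌋ : ℝ) * δ with hk
  have hk1 : k ≤ t := by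
    have := Int.floor_le (t / δ)
    rw [le_div_iff₀ hδ] at this; exact this
  have hk2 : t < k + δ := by
    have := Int.lt_floor_add_one (t / δ)
    rw [div_lt_iff₀ hδ] at this; rw [hk]; linarith
  have e : p t - cellAvg p δ t = δ⁻¹ * ∫ v in (0:ℝ)..δ, (p t - p (k + v)) := by
    unfold cellAvg
    rw [intervalIntegral.integral_sub (by simp) (Continuous.intervalIntegrable (by fun_prop) _ _),
      intervalIntegral.integral_const, smul_eq_mul, mul_sub, sub_zero, ← mul_assoc, inv_mul_cancel₀ hδ.ne', one_mul]
  have e2 : ∫ v in (0:ℝ)..δ, (p t - p (k + v)) = ∫ h in (k - t)..(k + δ - t), (p t - p (t + h)) := by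
    have := intervalIntegral.integral_comp_add_left (a := (0:ℝ)) (b := δ) (fun h => p t - p (t + h)) (k - t)
    rw [show k - t + 0 = k - t by ring, show k - t + δ = k + δ - t by ring] at this
    rw [← this]
    congr 1; funext v; rw [show t + (k - t + v) = k + v by ring]
  rw [e, abs_mul, abs_of_pos (inv_pos.2 hδ), e2]
  gcongr
  refine (intervalIntegral.abs_integral_le_integral_abs (by linarith)).trans ?_
  simp_rw [abs_sub_comm (p t)]
  apply intervalIntegral.integral_mono_interval (by linarith) (by linarith) (by linarith)
  · exact Eventually.of_forall fun h => abs_nonneg _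
  · exact Continuous.intervalIntegrable (by fun_prop) _ _

lemma cellAvg_L1 {p : ℝ → ℝ} (hp : Continuous p) {δ B : ℝ} (hδ : 0 < δ)
    (hB : ∀ h, ∫ t in (0:ℝ)..(2 * π), |p (t + h) - p t| ≤ B * |h|) :
    ∫ t in (0:ℝ)..(2 * π), ∫ h in (-δ)..δ, |p (t + h) - p t| ≤ 2 * B * δ ^ 2 := by
  have hB0 : 0 ≤ B := by
    have := hB 1
    rw [abs_one, mul_one] at this
    refine le_trans ?_ this
    exact intervalIntegral.integral_nonneg (by positivity) fun _ _ => abs_nonneg _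
  rw [MeasureTheory.intervalIntegral_intervalIntegral_swap]
  · have : ∫ h in (-δ)..δ, ∫ t in (0:ℝ)..(2 * π), |p (t + h) - p t| ≤ ∫ h in (-δ)..δ, B * δ := by
      apply intervalIntegral.integral_mono_on (by linarith)
      · apply Continuous.intervalIntegrable
        apply intervalIntegral.continuous_parametric_intervalIntegral_of_continuous' (by fun_prop)
      · simp
      · intro h hh
        refine (hB h).trans ?_
        gcongr
        exact abs_le.2 hh
    rw [intervalIntegral.integral_const, smul_eq_mul] at this
    linarith
  · have hc : Continuous (Function.uncurry fun t h => |p (t + h) - p t|) := by fun_prop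
    have hK : IsCompact (Set.uIcc (0:ℝ) (2*π) ×ˢ Set.uIcc (-δ) δ) := isCompact_uIcc.prod isCompact_uIcc
    exact (hc.continuousOn.integrableOn_compact hK).mono_set (Set.prod_mono Set.uIoc_subset_uIcc Set.uIoc_subset_uIcc)

lemma cellAvg_bound {p : ℝ → ℝ} {δ B : ℝ} (hδ : 0 < δ) (hB : ∀ t, |p t| ≤ B) (t : ℝ) : |cellAvg p δ t| ≤ B := by
  unfold cellAvg
  rw [abs_mul, abs_of_pos (inv_pos.2 hδ)]
  have := intervalIntegral.norm_integral_le_of_norm_le_const (a := 0) (b := δ) (C := B) (f := fun v => p (⌊t / δ⌋ * δ + v)) (fun v _ => hB _)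
  rw [Real.norm_eq_abs, sub_zero, abs_of_pos hδ] at this
  rw [inv_mul_le_iff₀ hδ]; linarith

lemma cellAvg_total {p : ℝ → ℝ} (hp : Continuous p) {δ B : ℝ} (hδ : 0 < δ) {C : ℝ} (hC : ∀ t, |p t| ≤ C)
    (hB : ∀ h, ∫ t in (0:ℝ)..(2 * π), |p (t + h) - p t| ≤ B * |h|) :
    ∫ t in (0:ℝ)..(2 * π), |p t - cellAvg p δ t| ≤ 2 * B * δ := by
  have h1 := cellAvg_L1 hp hδ hB
  have hcont : Continuous (fun t => ∫ h in (-δ)..δ, |p (t + h) - p t|) := by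
    apply intervalIntegral.continuous_parametric_intervalIntegral_of_continuous' (by fun_prop)
  have h2 : ∫ t in (0:ℝ)..(2 * π), |p t - cellAvg p δ t| ≤ ∫ t in (0:ℝ)..(2 * π), δ⁻¹ * ∫ h in (-δ)..δ, |p (t + h) - p t| := by
    apply intervalIntegral.integral_mono_on (by positivity)
    · refine (intervalIntegrable_const (c := C + C)).mono_fun (by
        exact ((hp.measurable.sub (cellAvg_meas p δ)).abs).aestronglyMeasurable) ?_
      refine Eventually.of_forall fun t => ?_
      have hC0 : 0 ≤ C := (abs_nonneg _).trans (hC 0)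
      beta_reduce
      rw [Real.norm_eq_abs, Real.norm_eq_abs, abs_abs, abs_of_nonneg (by linarith : 0 ≤ C + C)]
      exact (abs_sub _ _).trans (add_le_add (hC t) (cellAvg_bound hδ hC t))
    · exact Continuous.intervalIntegrable (by fun_prop) _ _
    · intro t _; exact cellAvg_sub hp hδ t
  rw [intervalIntegral.integral_const_mul] at h2
  refine h2.trans ?_
  rw [inv_mul_le_iff₀ hδ]
  linarith

def QQ (q : ℕ → ℝ) (n : ℕ) (θ : ℝ) (t : ℝ) : ℝ := ∑' m : ℕ, q m * Real.cos ((n + m) * t + θ)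

section
variable {q : ℕ → ℝ}

lemma Qterm (h0 : ∀ j, 0 ≤ q j) (x : ℕ → ℝ) (hx : ∀ j, |x j| ≤ 1) (j : ℕ) : ‖q j * x j‖ ≤ q j := by
  rw [norm_mul, Real.norm_eq_abs, Real.norm_eq_abs, abs_of_nonneg (h0 j)]
  nlinarith [hx j, h0 j]

lemma QQ_cont (h0 : ∀ j, 0 ≤ q j) (hs : Summable q) (n : ℕ) (θ : ℝ) : Continuous (QQ q n θ) :=
  continuous_tsum (fun l => by fun_prop) hs (fun l t => Qterm h0 (fun l => Real.cos ((n + l) * t + θ)) (fun j => Real.abs_cos_le_one _) l)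

lemma QQ_bound (h0 : ∀ j, 0 ≤ q j) (hs : Summable q) (n : ℕ) (θ t : ℝ) : |QQ q n θ t| ≤ ∑' j, q j :=
  tsum_of_norm_bounded hs.hasSum (fun l => Qterm h0 (fun l => Real.cos ((n + l) * t + θ)) (fun j => Real.abs_cos_le_one _) l)

lemma QQ_per (n : ℕ) (θ : ℝ) : Function.Periodic (QQ q n θ) (2 * π) := by
  intro t
  unfold QQ
  congr 1; funext m
  rw [show ((n:ℝ) + m) * (t + 2 * π) + θ = ((n + m) * t + θ) + ((n + m : ℕ) : ℝ) * (2 * π) by push_cast; ring,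
    Real.cos_add_nat_mul_two_pi]

lemma QQ_abel (h0 : ∀ j, 0 ≤ q j) (ha : Antitone q) (hs : Summable q) (n : ℕ) (θ t : ℝ) :
    |QQ q n θ t| * (2 * |Real.sin (t/2)|) ≤ 2 * q 0 := by
  set s : ℕ → ℝ := fun m => Real.sin ((n + m - 1/2) * t + θ) with hsdef
  have hs1 : ∀ j, |s j| ≤ 1 := fun j => Real.abs_sin_le_one _
  have hs2 : ∀ j, |s (j+1)| ≤ 1 := fun j => Real.abs_sin_le_one _
  have e1 : ∀ m : ℕ, q m * Real.cos ((n + m) * t + θ) * (2 * Real.sin (t/2)) = q m * s (m+1) - q m * s m := by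
    intro m
    simp only [hsdef]
    push_cast
    rw [show ((n:ℝ) + (m + 1) - 1/2) * t + θ = ((n + m) * t + θ) + t/2 by ring,
      show ((n:ℝ) + m - 1/2) * t + θ = ((n + m) * t + θ) - t/2 by ring, Real.sin_add, Real.sin_sub]
    ring
  have S1 : Summable (fun m => q m * s (m+1)) := Summable.of_norm_bounded hs (Qterm h0 (fun m => s (m+1)) hs2)
  have S2 : Summable (fun m => q m * s m) := Summable.of_norm_bounded hs (Qterm h0 s hs1)
  have S3 : Summable (fun m => q (m+1) * s (m+1)) := (summable_nat_add_iff 1).2 S2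
  have e2 : QQ q n θ t * (2 * Real.sin (t/2)) = (∑' m, (q m - q (m+1)) * s (m+1)) - q 0 * s 0 := by
    unfold QQ
    rw [← tsum_mul_right]
    simp_rw [e1, sub_mul]
    rw [S1.tsum_sub S2, S2.tsum_eq_zero_add, S1.tsum_sub S3]; ring
  have hd0 : ∀ m, 0 ≤ q m - q (m+1) := fun m => by have := ha (Nat.le_succ m); simp at this; linarith
  have hsq : Summable (fun m => q (m+1)) := (summable_nat_add_iff 1).2 hs
  have hb : |∑' m, (q m - q (m+1)) * s (m+1)| ≤ ∑' m, (q m - q (m+1)) :=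
    tsum_of_norm_bounded (hs.sub hsq).hasSum (Qterm hd0 (fun m => s (m+1)) hs2)
  have hb2 : ∑' m, (q m - q (m+1)) = q 0 := by
    rw [hs.tsum_sub hsq, hs.tsum_eq_zero_add]; ring
  rw [hb2] at hb
  have : |QQ q n θ t| * (2 * |Real.sin (t/2)|) = |QQ q n θ t * (2 * Real.sin (t/2))| := by
    rw [abs_mul, abs_mul, abs_two]
  rw [this, e2]
  have h3 : |q 0 * s 0| ≤ q 0 := Qterm h0 s hs1 0
  have := abs_sub (∑' m, (q m - q (m+1)) * s (m+1)) (q 0 * s 0)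
  linarith

lemma QQ_L1 (h0 : ∀ j, 0 ≤ q j) (ha : Antitone q) (hs : Summable q) (n : ℕ) (θ c : ℝ) {L : ℝ} (hL : 1 ≤ L)
    (hLq : ∑' j, q j ≤ 4 * L * q 0) :
    ∫ t in (0:ℝ)..(2 * π), |QQ q n θ (c + t)| ≤ 16 * q 0 * Real.log (1 + π * L) := by
  have hpi := Real.pi_pos
  have hc := QQ_cont h0 hs n θ
  have hL0 : 0 < L := by linarith
  have e : ∫ t in (0:ℝ)..(2 * π), |QQ q n θ (c + t)| = ∫ t in (-π)..π, |QQ q n θ t| := by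
    rw [intervalIntegral.integral_comp_add_left (fun t => |QQ q n θ t|)]
    have hp : Function.Periodic (fun t => |QQ q n θ t|) (2 * π) := fun t => by simp only [QQ_per n θ t]
    have := hp.intervalIntegral_add_eq c (-π)
    rw [show -π + 2 * π = π by ring] at this
    simpa using this
  have pw : ∀ t ∈ Set.Icc (-π) π, |QQ q n θ t| ≤ 8 * L * q 0 * (1 + L * |t|)⁻¹ := by
    intro t ht
    have ht' : |t| ≤ π := abs_le.2 ht
    have h1 := QQ_abel h0 ha hs n θ t
    have h2 := (QQ_bound h0 hs n θ t).trans hLq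
    have h3 := Real.mul_abs_le_abs_sin (x := t / 2) (by rw [abs_div, abs_two]; linarith)
    rw [abs_div, abs_two] at h3
    have hq : 0 < 1 + L * |t| := by positivity
    rw [← div_eq_mul_inv, le_div_iff₀ hq]
    have h4 : |QQ q n θ t| * (2 / π * |t|) ≤ 2 * q 0 := by
      refine le_trans ?_ h1
      refine mul_le_mul_of_nonneg_left ?_ (abs_nonneg _)
      linarith
    have h5 : |QQ q n θ t| * |t| ≤ π * q 0 := by
      have : |QQ q n θ t| * (2 / π * |t|) = 2 / π * (|QQ q n θ t| * |t|) := by ring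
      rw [this, div_mul_eq_mul_div, div_le_iff₀ Real.pi_pos] at h4
      linarith
    have h6 : π ≤ 4 := Real.pi_le_four
    have h7 := h0 0
    have h8 : |QQ q n θ t| * |t| * L ≤ 4 * q 0 * L := by
      exact mul_le_mul_of_nonneg_right (h5.trans (mul_le_mul_of_nonneg_right h6 h7)) hL0.le
    linarith
  rw [e]
  have hne : ∀ t : ℝ, 1 + L * |t| ≠ 0 := fun t => by positivity
  have hci : Continuous (fun t : ℝ => (1 + L * |t|)⁻¹) := by fun_prop (disch := assumption)
  have h1 := intervalIntegral.integral_mono_on (μ := volume) (a := -π) (b := π) (by linarith)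
    (Continuous.intervalIntegrable (by fun_prop) _ _)
    (Continuous.intervalIntegrable (by fun_prop) _ _) pw
  refine h1.trans ?_
  rw [intervalIntegral.integral_const_mul]
  have i1 : ∫ t in (0:ℝ)..π, (1 + L * |t|)⁻¹ = L⁻¹ * Real.log (1 + π * L) := by
    have : ∫ t in (0:ℝ)..π, (1 + L * |t|)⁻¹ = ∫ t in (0:ℝ)..π, (L * t + 1)⁻¹ := by
      apply intervalIntegral.integral_congr
      intro t ht
      rw [Set.uIcc_of_le hpi.le] at ht
      simp only [abs_of_nonneg ht.1, add_comm]
    rw [this, intervalIntegral.integral_comp_mul_add (fun x => x⁻¹) hL0.ne', integral_inv_of_pos (by norm_num) (by positivity), smul_eq_mul]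
    simp; left; congr 1; ring
  have i2 : ∫ t in (-π)..0, (1 + L * |t|)⁻¹ = L⁻¹ * Real.log (1 + π * L) := by
    rw [← i1]
    have := intervalIntegral.integral_comp_neg (a := 0) (b := π) (fun t => (1 + L * |t|)⁻¹)
    rw [neg_zero] at this
    rw [← this]; simp
  rw [← intervalIntegral.integral_add_adjacent_intervals (hci.intervalIntegrable (-π) 0) (hci.intervalIntegrable 0 π), i1, i2]
  apply le_of_eq; field_simp; ring

end


open scoped ENNReal in
lemma mink0 {α β : Type*} [MeasurableSpace α] [MeasurableSpace β] (μ : Measure α) (ν : Measure β) [SFinite μ] [SFinite ν]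
    {p : ℝ} (hp : 1 < p) {G : α → β → ℝ≥0∞} (hG : AEMeasurable (Function.uncurry G) (μ.prod ν))
    {m : β → ℝ≥0∞} (hm : AEMeasurable m ν) (hm0 : ∀ t, m t ≠ 0) (hmt : ∀ t, m t ≠ ∞)
    (hb : ∀ᵐ t ∂ν, ∫⁻ x, G x t ^ p ∂μ ≤ m t ^ p) :
    ∫⁻ x, (∫⁻ t, G x t ∂ν) ^ p ∂μ ≤ (∫⁻ t, m t ∂ν) ^ p := by
  have hpq := Real.HolderConjugate.conjExponent hp
  set q := p.conjExponent with hq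
  have hp0 : 0 < p := by linarith
  have hq0 : 0 < q := hpq.symm.pos
  have hpq1 : p / q = p - 1 := hpq.div_conj_eq_sub_one
  -- pointwise Hoelder
  have h1 : ∀ᵐ x ∂μ, (∫⁻ t, G x t ∂ν) ^ p ≤ (∫⁻ t, G x t ^ p * m t ^ (-(p-1)) ∂ν) * (∫⁻ t, m t ∂ν) ^ (p-1) := by
    filter_upwards [hG.aestronglyMeasurable.prodMk_left] with x hx0
    have hx := hx0.aemeasurable
    have hx' : AEMeasurable (fun t => G x t) ν := hx
    have := ENNReal.lintegral_mul_le_Lp_mul_Lq ν hpq (f := fun t => G x t * m t ^ (-(1/q))) (g := fun t => m t ^ (1/q))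
      (hx'.mul (hm.pow_const _)) (hm.pow_const _)
    have e1 : ∫⁻ t, G x t ∂ν = ∫⁻ t, ((fun t => G x t * m t ^ (-(1/q))) * (fun t => m t ^ (1/q))) t ∂ν := by
      congr 1; funext t
      simp only [Pi.mul_apply]
      rw [mul_assoc, ← ENNReal.rpow_add _ _ (hm0 t) (hmt t)]; simp
    have e2 : ∀ t, (G x t * m t ^ (-(1/q))) ^ p = G x t ^ p * m t ^ (-(p-1)) := by
      intro t
      rw [ENNReal.mul_rpow_of_nonneg _ _ hp0.le, ← ENNReal.rpow_mul, ← hpq1]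
      congr 2; ring
    have e3 : ∀ t, (m t ^ (1/q)) ^ q = m t := by
      intro t
      rw [← ENNReal.rpow_mul, one_div, inv_mul_cancel₀ hq0.ne', ENNReal.rpow_one]
    rw [← e1] at this
    simp_rw [e2, e3] at this
    refine (ENNReal.rpow_le_rpow this hp0.le).trans (le_of_eq ?_)
    rw [ENNReal.mul_rpow_of_nonneg _ _ hp0.le, ← ENNReal.rpow_mul, ← ENNReal.rpow_mul, one_div, inv_mul_cancel₀ hp0.ne', ENNReal.rpow_one, ← hpq1]
    congr 2; ring
  have hGm : AEMeasurable (Function.uncurry fun x t => G x t ^ p * m t ^ (-(p-1))) (μ.prod ν) :=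
    (hG.pow_const p).mul ((hm.pow_const (-(p-1))).comp_snd)
  calc _ ≤ ∫⁻ x, (∫⁻ t, G x t ^ p * m t ^ (-(p-1)) ∂ν) * (∫⁻ t, m t ∂ν) ^ (p-1) ∂μ := lintegral_mono_ae h1
    _ = (∫⁻ x, (∫⁻ t, G x t ^ p * m t ^ (-(p-1)) ∂ν) ∂μ) * (∫⁻ t, m t ∂ν) ^ (p-1) :=
        lintegral_mul_const'' _ hGm.lintegral_prod_right'
    _ = (∫⁻ t, (∫⁻ x, G x t ^ p * m t ^ (-(p-1)) ∂μ) ∂ν) * (∫⁻ t, m t ∂ν) ^ (p-1) := by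
        rw [lintegral_lintegral_swap hGm]
    _ ≤ (∫⁻ t, m t ∂ν) * (∫⁻ t, m t ∂ν) ^ (p-1) := by
        gcongr ?_ * _
        apply lintegral_mono_ae
        filter_upwards [hb] with t ht
        rw [lintegral_mul_const']
        · calc _ ≤ m t ^ p * m t ^ (-(p-1)) := by gcongr
            _ = m t := by rw [← ENNReal.rpow_add _ _ (hm0 t) (hmt t)]; simp
        · simp [hm0 t, hmt t]
    _ = _ := by
        conv_lhs => rw [← ENNReal.rpow_one (∫⁻ t, m t ∂ν), ← ENNReal.rpow_mul, one_mul]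
        rw [← ENNReal.rpow_add_of_nonneg _ _ (by norm_num) (by linarith)]
        congr 1; ring

def PM : Measure ℝ := volume.restrict (Set.Ioc (-π) π)

open scoped ENNReal in
def NN (p : ℝ) (h : ℝ → ℝ) : ℝ≥0∞ := eLpNorm h (ENNReal.ofReal p) PM

instance : IsFiniteMeasure PM := by unfold PM; infer_instance

open scoped ENNReal in
lemma NN_eq {p : ℝ} (hp : 1 < p) (h : ℝ → ℝ) : NN p h = (∫⁻ x, ‖h x‖ₑ ^ p ∂PM) ^ (1/p) := by
  unfold NN
  rw [eLpNorm_eq_lintegral_rpow_enorm_toReal (by simp; linarith) (by simp), ENNReal.toReal_ofReal (by linarith)]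

open scoped ENNReal in
lemma mink {p : ℝ} (hp : 1 < p) {F : ℝ → ℝ → ℝ} {a b : ℝ} (hab : a ≤ b)
    (hF : AEStronglyMeasurable (Function.uncurry F) (PM.prod (volume.restrict (Set.Ioc a b))))
    {m : ℝ → ℝ} (hm : IntervalIntegrable m volume a b) (hm0 : ∀ t ∈ Set.Ioc a b, 0 ≤ m t)
    (hb : ∀ t ∈ Set.Ioc a b, NN p (fun x => F x t) ≤ ENNReal.ofReal (m t)) :
    NN p (fun x => ∫ s in a..b, F x s) ≤ ENNReal.ofReal (∫ s in a..b, m s) := by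
  have hp0 : 0 < p := by linarith
  set ν := (volume.restrict (Set.Ioc a b)) with hν
  have hmi : Integrable m ν := (intervalIntegrable_iff_integrableOn_Ioc_of_le hab).1 hm
  have key : ∀ ε : ℝ, 0 < ε → NN p (fun x => ∫ s in a..b, F x s) ≤ ENNReal.ofReal ((∫ s in a..b, m s) + ε * (b-a)) := by
    intro ε hε
    have hae : ∀ᵐ t ∂ν, 0 ≤ m t := (ae_restrict_iff' measurableSet_Ioc).2 (Eventually.of_forall hm0)
    have := mink0 PM ν hp (G := fun x t => ‖F x t‖ₑ) hF.enorm
      (m := fun t => ENNReal.ofReal (|m t| + ε)) ((hmi.aemeasurable.abs.add_const ε).ennreal_ofReal)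
      (fun t => by simp; positivity) (fun t => by simp) (by
        refine (ae_restrict_iff' measurableSet_Ioc).2 (Eventually.of_forall ?_)
        intro t ht
        have h1 := hb t ht
        rw [NN_eq hp] at h1
        have h2 := ENNReal.rpow_le_rpow h1 hp0.le
        rw [← ENNReal.rpow_mul, one_div, inv_mul_cancel₀ hp0.ne', ENNReal.rpow_one] at h2
        refine h2.trans (ENNReal.rpow_le_rpow (ENNReal.ofReal_le_ofReal ?_) hp0.le)
        have := le_abs_self (m t); linarith)
    have e : ∫⁻ t, ENNReal.ofReal (|m t| + ε) ∂ν = ENNReal.ofReal ((∫ s in a..b, m s) + ε * (b-a)) := by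
      rw [← ofReal_integral_eq_lintegral_ofReal (f := fun t => |m t| + ε) (hmi.abs.add (integrable_const ε)) (Eventually.of_forall fun t => by show (0:ℝ) ≤ |m t| + ε; positivity)]
      congr 1
      rw [integral_add hmi.abs (integrable_const ε)]
      congr 1
      · rw [intervalIntegral.integral_of_le hab]
        apply integral_congr_ae
        filter_upwards [hae] with t ht
        exact abs_of_nonneg ht
      · simp [hν, hab, mul_comm]
    rw [e] at this
    rw [NN_eq hp]
    have h3 : ∫⁻ x, ‖∫ s in a..b, F x s‖ₑ ^ p ∂PM ≤ ∫⁻ x, (∫⁻ t, ‖F x t‖ₑ ∂ν) ^ p ∂PM := by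
      apply lintegral_mono
      intro x
      refine ENNReal.rpow_le_rpow ?_ hp0.le
      rw [intervalIntegral.integral_of_le hab]
      exact enorm_integral_le_lintegral_enorm _
    have h4 := ENNReal.rpow_le_rpow (h3.trans this) (by positivity : 0 ≤ 1/p)
    rwa [← ENNReal.rpow_mul, mul_one_div_cancel hp0.ne', ENNReal.rpow_one] at h4
  have lim : Tendsto (fun ε : ℝ => ENNReal.ofReal ((∫ s in a..b, m s) + ε * (b-a))) (nhdsWithin 0 (Set.Ioi 0)) (nhds (ENNReal.ofReal ((∫ s in a..b, m s) + 0 * (b-a)))) := by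
    apply Tendsto.mono_left _ nhdsWithin_le_nhds
    apply Continuous.tendsto
    exact ENNReal.continuous_ofReal.comp (by fun_prop)
  rw [zero_mul, add_zero] at lim
  refine ge_of_tendsto lim ?_
  filter_upwards [self_mem_nhdsWithin] with ε hε using key ε hε

lemma NN_per {p : ℝ} (hp : 1 < p) {φ : ℝ → ℝ} (hφ : Function.Periodic φ (2 * π)) (c : ℝ) :
    NN p (fun x => φ (x + c)) = NN p φ := by
  rw [NN_eq hp, NN_eq hp]
  congr 1
  have h1 : ∫⁻ x, ‖φ (x + c)‖ₑ ^ p ∂PM = ∫⁻ x in Set.Ioc (-π + c) (-π + c + 2 * π), ‖φ x‖ₑ ^ p := by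
    have := (measurePreserving_add_right volume c).setLIntegral_comp_emb (measurableEmbedding_addRight c) (fun x => ‖φ x‖ₑ ^ p) (Set.Ioc (-π) π)
    unfold PM
    rw [this]
    congr 2
    simp; ring_nf
  rw [h1]
  have : PM = volume.restrict (Set.Ioc (-π) (-π + 2 * π)) := by unfold PM; congr 2; ring
  rw [this]
  have : VAddInvariantMeasure (AddSubgroup.zmultiples (2*π)) ℝ volume := ⟨fun c s _ => measure_preimage_add _ _ _⟩
  apply IsAddFundamentalDomain.setLIntegral_eq (G := AddSubgroup.zmultiples (2 * π))
  exacts [isAddFundamentalDomain_Ioc two_pi_pos _, isAddFundamentalDomain_Ioc two_pi_pos _, fun g x => by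
    rw [hφ.map_vadd_zmultiples]]

lemma memLp_iff {p : ℝ} (hp : 1 < p) {g : ℝ → ℝ} (hg : AEStronglyMeasurable g volume) :
    MemLp g (ENNReal.ofReal p) PM ↔ IntervalIntegrable (fun x => |g x| ^ p) volume (-π) π := by
  rw [intervalIntegrable_iff_integrableOn_Ioc_of_le (by linarith [pi_pos])]
  have hg' : AEStronglyMeasurable g PM := hg.restrict
  have := integrable_norm_rpow_iff (p := ENNReal.ofReal p) hg' (by simp; linarith) (by simp)
  rw [← this, ENNReal.toReal_ofReal (by linarith)]
  rfl

lemma NN_eq_ofReal {p : ℝ} (hp : 1 < p) {g : ℝ → ℝ} (hg : MemLp g (ENNReal.ofReal p) PM) :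
    NN p g = ENNReal.ofReal (LpNormP p g) := by
  unfold NN LpNormP
  rw [hg.eLpNorm_eq_integral_rpow_norm (by simp; linarith) (by simp), ENNReal.toReal_ofReal (by linarith),
    intervalIntegral.integral_of_le (by linarith [pi_pos]), one_div]
  rfl

lemma LpNormP_le {p : ℝ} (hp : 1 < p) {g : ℝ → ℝ} (hg : AEStronglyMeasurable g volume) {B : ℝ} (hB : 0 ≤ B)
    (h : NN p g ≤ ENNReal.ofReal B) : LpNormP p g ≤ B := by
  have hm : MemLp g (ENNReal.ofReal p) PM := ⟨hg.restrict, h.trans_lt (by simp)⟩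
  rw [NN_eq_ofReal hp hm] at h
  exact (ENNReal.ofReal_le_ofReal_iff hB).1 h


lemma aesm_shift {φ : ℝ → ℝ} (hφ : AEStronglyMeasurable φ volume) (c : ℝ) :
    AEStronglyMeasurable (fun x => φ (x + c)) volume :=
  hφ.comp_measurePreserving (measurePreserving_add_right volume c)

lemma jm_sub {φ : ℝ → ℝ} (hφ : AEStronglyMeasurable φ volume) (c a b : ℝ) :
    AEStronglyMeasurable (Function.uncurry fun x s => φ (x - c - s)) (PM.prod (volume.restrict (Set.Ioc a b))) := by
  have h1 : AEStronglyMeasurable (fun x => φ (x + -c)) volume := aesm_shift hφ (-c)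
  have h2 := h1.comp_quasiMeasurePreserving (quasiMeasurePreserving_sub_of_right_invariant (volume : Measure ℝ) volume)
  have h3 : AEStronglyMeasurable (Function.uncurry fun x s => φ (x - c - s)) ((volume : Measure ℝ).prod volume) := by
    refine h2.congr (Eventually.of_forall ?_)
    rintro ⟨x, s⟩
    simp only [Function.comp, Function.uncurry]
    congr 1; ring
  unfold PM
  rw [Measure.prod_restrict]
  exact h3.restrict

lemma jm_add {φ : ℝ → ℝ} (hφ : AEStronglyMeasurable φ volume) (c a b : ℝ) :
    AEStronglyMeasurable (Function.uncurry fun x s => φ (x - c + s)) (PM.prod (volume.restrict (Set.Ioc a b))) := by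
  have h1 : AEStronglyMeasurable (fun x => φ (-x + -c)) volume :=
    (aesm_shift hφ (-c)).comp_measurePreserving (Measure.measurePreserving_neg volume)
  have h2 := h1.comp_quasiMeasurePreserving (quasiMeasurePreserving_sub_of_right_invariant (volume : Measure ℝ) volume)
  have h2' := h2.comp_measurePreserving (Measure.measurePreserving_swap (μ := (volume : Measure ℝ)) (ν := (volume : Measure ℝ)))
  have h3 : AEStronglyMeasurable (Function.uncurry fun x s => φ (x - c + s)) ((volume : Measure ℝ).prod volume) := by
    have hm : MeasurePreserving (fun z : ℝ × ℝ => (z.1, -z.2)) ((volume : Measure ℝ).prod volume) ((volume : Measure ℝ).prod volume) :=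
      (MeasurePreserving.id volume).prod (Measure.measurePreserving_neg volume)
    have h4 : AEStronglyMeasurable (fun x => φ (x + -c)) volume := aesm_shift hφ (-c)
    have h5 := (h4.comp_quasiMeasurePreserving (quasiMeasurePreserving_sub_of_right_invariant (volume : Measure ℝ) volume)).comp_measurePreserving hm
    refine h5.congr (Eventually.of_forall ?_)
    rintro ⟨x, s⟩
    simp only [Function.comp, Function.uncurry]
    congr 1; ring
  unfold PM
  rw [Measure.prod_restrict]
  exact h3.restrict

lemma NN_smul (p : ℝ) (g : ℝ → ℝ) (c : ℝ) : NN p (fun x => g x * c) = ENNReal.ofReal |c| * NN p g := by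
  unfold NN
  have := eLpNorm_const_smul c g (ENNReal.ofReal p) PM
  rw [← Real.norm_eq_abs, ofReal_norm, ← this]
  congr 1; funext x; simp [mul_comm]

lemma Wconv {p : ℝ} (hp : 1 < p) {φ : ℝ → ℝ} (hφ : AEStronglyMeasurable φ volume) (hper : Function.Periodic φ (2 * π))
    {A : ℝ} (hA : 0 ≤ A) (hN : NN p φ ≤ ENNReal.ofReal A) {W : ℝ → ℝ} {a b : ℝ} (hab : a ≤ b)
    (hW : IntervalIntegrable W volume a b) (c : ℝ) :
    NN p (fun x => ∫ s in a..b, φ (x - c - s) * W s) ≤ ENNReal.ofReal (A * ∫ s in a..b, |W s|) := by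
  rw [← intervalIntegral.integral_const_mul]
  have hWi := (intervalIntegrable_iff_integrableOn_Ioc_of_le hab).1 hW
  refine mink hp hab ?_ (hW.abs.const_mul A) (fun t _ => by positivity) ?_
  · exact (jm_sub hφ c a b).mul (hWi.aestronglyMeasurable.comp_snd)
  · intro t _
    rw [NN_smul p (fun x => φ (x - c - t))]
    have : (fun x => φ (x - c - t)) = fun x => φ (x + (-c - t)) := by funext x; congr 1; ring
    rw [this, NN_per hp hper, mul_comm A, ENNReal.ofReal_mul (abs_nonneg _)]
    gcongr

lemma mod_le {ω : ℝ → ℝ} (hω : IsModulus ω) {n : ℕ} (hn : 1 ≤ n) {t : ℝ} (ht : 0 ≤ t) :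
    ω t ≤ (1 + n * t) * ω (1 / n) := by
  obtain ⟨hc, hmono, hsub, h0, hnn⟩ := hω
  have hn0 : (0:ℝ) < n := by exact_mod_cast hn
  have h1 : ∀ k : ℕ, ω (k * (1/n)) ≤ k * ω (1/n) := by
    intro k
    induction k with
    | zero => simp [h0]
    | succ k ih =>
      have := hsub (k * (1/n)) (1/n) (by positivity) (by positivity)
      push_cast
      rw [add_mul, one_mul, add_mul, one_mul]; linarith
  have h2 : ω t ≤ ω (⌈n * t⌉₊ * (1/n)) := by
    apply hmono ht (by simp; positivity)
    have := Nat.le_ceil (n * t)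
    rw [mul_one_div, le_div_iff₀ hn0]; linarith
  have h3 := (Nat.ceil_lt_add_one (by positivity : 0 ≤ n * t)).le
  have h4 := hnn (1/n) (by positivity)
  refine h2.trans ((h1 _).trans ?_)
  gcongr; linarith

lemma loc_int {p : ℝ} (hp : 1 < p) {φ : ℝ → ℝ} (hφ : MemLpP p φ) (hper : Function.Periodic φ (2 * π)) (a b : ℝ) :
    IntervalIntegrable φ volume a b := by
  have h1 := (memLp_iff hp hφ.1).2 hφ.2
  have h2 : Integrable φ PM := h1.integrable (by simp; linarith)
  have h3 : IntervalIntegrable φ volume (-π) (-π + 2 * π) := by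
    rw [intervalIntegrable_iff_integrableOn_Ioc_of_le (by linarith [pi_pos]), show -π + 2 * π = π by ring]
    exact h2
  exact hper.intervalIntegrable (by positivity) h3 a b

lemma loc_sub {φ : ℝ → ℝ} (hφ : ∀ a b, IntervalIntegrable φ volume a b) (c a b : ℝ) :
    IntervalIntegrable (fun s => φ (c - s)) volume a b := by
  have := (hφ (c - a) (c - b)).comp_sub_left c
  simpa using this

lemma tilde_bound {p : ℝ} (hp : 1 < p) {φ ω : ℝ → ℝ} (hφ : AEStronglyMeasurable φ volume)
    (hloc : ∀ a b, IntervalIntegrable φ volume a b)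
    (hω : IsModulus ω) (hN : ∀ h, NN p (fun x => φ (x + h) - φ x) ≤ ENNReal.ofReal (ω |h|))
    {n : ℕ} (hn : 1 ≤ n) {J : ℝ → ℝ} (hJc : Continuous J) (hJ1 : ∫ t in (-π)..π, J t = 1) {C : ℝ}
    (hJ : ∫ t in (-π)..π, |J t| * (1 + n * |t|) ≤ C) :
    NN p (fun x => φ x - ∫ t in (-π)..π, φ (x - t) * J t) ≤ ENNReal.ofReal (C * ω (1 / n)) := by
  have hpi := pi_pos
  have hωn : 0 ≤ ω (1/n) := hω.2.2.2.2 _ (by positivity)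
  have e : (fun x => φ x - ∫ t in (-π)..π, φ (x - t) * J t) = fun x => ∫ t in (-π)..π, (φ (x - t) - φ x) * (-J t) := by
    funext x
    have i1 : IntervalIntegrable (fun t => φ (x - t) * J t) volume (-π) π :=
      (loc_sub hloc x _ _).mul_continuousOn hJc.continuousOn
    have i2 : IntervalIntegrable (fun t => φ x * J t) volume (-π) π := (by fun_prop : Continuous fun t => φ x * J t).intervalIntegrable _ _
    have : (fun t => (φ (x - t) - φ x) * (-J t)) = fun t => φ x * J t - φ (x - t) * J t := by funext t; ring
    rw [this, intervalIntegral.integral_sub i2 i1, intervalIntegral.integral_const_mul, hJ1, mul_one]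
  rw [e]
  have hm := mink hp (F := fun x t => (φ (x - t) - φ x) * (-J t)) (a := -π) (b := π) (by linarith)
    (m := fun t => (|J t| * (1 + n * |t|)) * ω (1/n)) ?_ (Continuous.intervalIntegrable (by fun_prop) _ _)
    (fun t _ => by positivity) ?_
  · refine hm.trans (ENNReal.ofReal_le_ofReal ?_)
    rw [intervalIntegral.integral_mul_const]
    gcongr
  · have h1 := jm_sub hφ 0 (-π) π
    simp only [sub_zero] at h1
    have h2 : AEStronglyMeasurable (Function.uncurry fun (x : ℝ) (_t : ℝ) => φ x) (PM.prod (volume.restrict (Set.Ioc (-π) π))) :=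
      (hφ.restrict (s := Set.Ioc (-π) π)).comp_fst
    exact (h1.sub h2).mul ((by fun_prop : Continuous (Function.uncurry fun (_x : ℝ) t => -J t)).aestronglyMeasurable)
  · intro t _
    rw [NN_smul p (fun x => φ (x - t) - φ x), abs_neg]
    have h1 := hN (-t)
    simp only [← sub_eq_add_neg, abs_neg] at h1
    calc _ ≤ ENNReal.ofReal |J t| * ENNReal.ofReal (ω |t|) := by gcongr
      _ = ENNReal.ofReal (|J t| * ω |t|) := (ENNReal.ofReal_mul (abs_nonneg _)).symm
      _ ≤ _ := by
        apply ENNReal.ofReal_le_ofReal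
        rw [mul_assoc]
        gcongr
        exact mod_le hω hn (abs_nonneg _)

lemma cell_bound {p : ℝ} (hp : 1 < p) {φ ω : ℝ → ℝ} (hφ : AEStronglyMeasurable φ volume) (hper : Function.Periodic φ (2 * π))
    (hloc : ∀ a b, IntervalIntegrable φ volume a b)
    (hω : IsModulus ω) (hN : ∀ h, NN p (fun x => φ (x + h) - φ x) ≤ ENNReal.ofReal (ω |h|))
    {n : ℕ} (hn : 1 ≤ n) (c : ℝ) :
    NN p (fun x => ∫ v in (0:ℝ)..(π/n), φ (x - c - v) * Real.cos (n * v)) ≤ ENNReal.ofReal (eN n ω / n) := by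
  have hpi := pi_pos
  have hn0 : (0:ℝ) < n := by exact_mod_cast hn
  set δ := π / n with hδ
  have hδ0 : 0 < δ := by positivity
  have hnδ : n * δ = π := by rw [hδ]; field_simp
  have e : (fun x => ∫ v in (0:ℝ)..δ, φ (x - c - v) * Real.cos (n * v)) =
      fun x => ∫ v in (0:ℝ)..(δ/2), (φ (x - c - v) - φ (x - (c + δ) + v)) * Real.cos (n * v) := by
    funext x
    have hi : ∀ a b, IntervalIntegrable (fun v => φ (x - c - v) * Real.cos (n * v)) volume a b := fun a b =>
      (loc_sub hloc (x - c) a b).mul_continuousOn (by fun_prop)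
    rw [← intervalIntegral.integral_add_adjacent_intervals (hi 0 (δ/2)) (hi (δ/2) δ)]
    have h2 : ∫ v in (δ/2)..δ, φ (x - c - v) * Real.cos (n * v) = ∫ v in (0:ℝ)..(δ/2), -(φ (x - (c + δ) + v) * Real.cos (n * v)) := by
      have := intervalIntegral.integral_comp_sub_left (a := 0) (b := δ/2) (fun v => φ (x - c - v) * Real.cos (n * v)) δ
      rw [sub_zero, show δ - δ/2 = δ/2 by ring] at this
      rw [← this]
      congr 1; funext v
      rw [show n * (δ - v) = π - n * v by rw [mul_sub, hnδ], Real.cos_pi_sub, show x - c - (δ - v) = x - (c + δ) + v by ring]; ring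
    have hi2 : IntervalIntegrable (fun v => -(φ (x - (c + δ) + v) * Real.cos (n * v))) volume 0 (δ/2) := by
      have := ((hi δ (δ/2)).comp_sub_left δ)
      simp only [sub_self, show δ - δ/2 = δ/2 by ring] at this
      refine this.congr ?_
      intro v _
      beta_reduce
      rw [show n * (δ - v) = π - n * v by rw [mul_sub, hnδ], Real.cos_pi_sub, show x - c - (δ - v) = x - (c + δ) + v by ring]; ring
    rw [h2, ← intervalIntegral.integral_add (hi _ _) hi2]
    congr 1; funext v; ring
  have e2 : eN n ω / n = ∫ v in (0:ℝ)..(δ/2), ω (δ - 2 * v) * Real.cos (n * v) := by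
    unfold eN
    have h1 := intervalIntegral.integral_comp_sub_mul (a := 0) (b := δ/2) (fun t => ω (2 * t / n) * Real.sin t) hn0.ne' (π/2)
    rw [mul_zero, sub_zero, show π/2 - n * (δ/2) = 0 by rw [← hnδ]; ring, smul_eq_mul] at h1
    rw [div_eq_inv_mul, ← h1]
    congr 1; funext v
    rw [Real.sin_pi_div_two_sub, show 2 * (π/2 - n * v) / n = δ - 2 * v by rw [hδ]; field_simp]
  have hωc : ContinuousOn (fun v => ω (δ - 2 * v) * Real.cos (n * v)) (Set.uIcc 0 (δ/2)) := by
    refine ContinuousOn.mul (hω.1.comp (by fun_prop) ?_) (by fun_prop)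
    intro v hv
    rw [Set.uIcc_of_le (by positivity)] at hv
    simp; linarith [hv.2]
  have hcos : ∀ t ∈ Set.Ioc 0 (δ/2), 0 ≤ Real.cos (n * t) := by
    intro t ht
    apply Real.cos_nonneg_of_neg_pi_div_two_le_of_le
    · have := mul_pos hn0 ht.1; linarith
    · calc n * t ≤ n * (δ/2) := by gcongr; exact ht.2
        _ = π/2 := by rw [← hnδ]; ring
  rw [e, e2]
  refine mink hp (by positivity) ?_ hωc.intervalIntegrable ?_ ?_
  · exact ((jm_sub hφ c 0 (δ/2)).sub (jm_add hφ (c+δ) 0 (δ/2))).mul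
      ((by fun_prop : Continuous (Function.uncurry fun (_x : ℝ) t => Real.cos (n * t))).aestronglyMeasurable)
  · intro t ht
    exact mul_nonneg (hω.2.2.2.2 _ (by linarith [ht.2])) (hcos t ht)
  · intro t ht
    rw [NN_smul p (fun x => φ (x - c - t) - φ (x - (c + δ) + t)), abs_of_nonneg (hcos t ht)]
    have hh : 0 ≤ δ - 2 * t := by linarith [ht.2]
    have h1 := hN (δ - 2 * t)
    rw [abs_of_nonneg hh] at h1
    have hpd : Function.Periodic (fun x => φ (x + (δ - 2 * t)) - φ x) (2 * π) := by
      intro x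
      beta_reduce
      rw [hper x, show x + 2 * π + (δ - 2 * t) = x + (δ - 2 * t) + 2 * π by ring, hper]
    rw [← NN_per hp hpd (-(c + δ) + t)] at h1
    have e3 : (fun x => φ (x - c - t) - φ (x - (c + δ) + t)) = fun x => φ (x + (-(c+δ) + t) + (δ - 2 * t)) - φ (x + (-(c+δ) + t)) := by
      funext x; congr 2 <;> ring
    rw [e3, mul_comm, ENNReal.ofReal_mul (hω.2.2.2.2 _ hh)]
    gcongr


def cellP (p : ℝ → ℝ) (δ : ℝ) (k : ℕ) : ℝ := δ⁻¹ * ∫ v in (0:ℝ)..δ, p (k * δ + v)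

lemma cellAvg_eq (p : ℝ → ℝ) {δ : ℝ} (hδ : 0 < δ) (k : ℕ) {v : ℝ} (h0 : 0 ≤ v) (h1 : v < δ) :
    cellAvg p δ (k * δ + v) = cellP p δ k := by
  have : ⌊(k * δ + v) / δ⌋ = (k : ℤ) := by
    rw [Int.floor_eq_iff]
    constructor
    · rw [le_div_iff₀ hδ]; push_cast; linarith
    · rw [div_lt_iff₀ hδ]; push_cast; linarith
  unfold cellAvg cellP
  rw [this]; simp

lemma cellP_sum {p : ℝ → ℝ} (hp : Continuous p) {δ : ℝ} (N : ℕ) :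
    ∑ k ∈ Finset.range N, cellP p δ k = δ⁻¹ * ∫ v in (0:ℝ)..(N * δ), p v := by
  unfold cellP
  rw [← Finset.mul_sum]
  congr 1
  have := intervalIntegral.sum_integral_adjacent_intervals (f := p) (μ := volume) (a := fun k : ℕ => (k:ℝ) * δ) (n := N)
    (fun k _ => hp.intervalIntegrable _ _)
  simp only [Nat.cast_zero, zero_mul] at this
  rw [← this]
  apply Finset.sum_congr rfl
  intro k _
  have := intervalIntegral.integral_comp_add_left (a := 0) (b := δ) p (k * δ)
  rw [this]; push_cast; congr 1 <;> ring

lemma cos_shift {n : ℕ} (hn : 1 ≤ n) (k : ℕ) (v : ℝ) : Real.cos (n * (k * (π / n) + v)) = (-1)^k * Real.cos (n * v) := by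
  have hn0 : (n:ℝ) ≠ 0 := by positivity
  rw [show n * (k * (π / n) + v) = n * v + k * π by field_simp; ring, Real.cos_add_nat_mul_pi]

lemma main_bound {p : ℝ} (hp : 1 < p) {φ ω : ℝ → ℝ} (hφ : AEStronglyMeasurable φ volume) (hper : Function.Periodic φ (2 * π))
    (hloc : ∀ a b, IntervalIntegrable φ volume a b)
    (hω : IsModulus ω) (hN : ∀ h, NN p (fun x => φ (x + h) - φ x) ≤ ENNReal.ofReal (ω |h|))
    {n : ℕ} (hn : 1 ≤ n) (c : ℝ) {P : ℝ → ℝ} (hP : Continuous P) (hP0 : ∀ t, 0 ≤ P t) :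
    NN p (fun x => ∫ s in (0:ℝ)..(2 * π), φ (x - c - s) * (Real.cos (n * s) * cellAvg P (π/n) s)) ≤
      ENNReal.ofReal (π⁻¹ * (∫ v in (0:ℝ)..(2 * π), P v) * eN n ω) := by
  have hpi := pi_pos
  have hn0 : (0:ℝ) < n := by exact_mod_cast hn
  set δ := π / n with hδ
  have hδ0 : 0 < δ := by positivity
  have h2 : ((2 * n : ℕ) : ℝ) * δ = 2 * π := by rw [hδ]; push_cast; field_simp
  have hPk : ∀ k, 0 ≤ cellP P δ k := fun k =>
    mul_nonneg (by positivity) (intervalIntegral.integral_nonneg hδ0.le fun _ _ => hP0 _)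
  -- pieces
  have piece : ∀ x (k : ℕ), Set.EqOn (fun v => φ (x - (c + k * δ) - v) * Real.cos (n * v) * ((-1)^k * cellP P δ k))
      (fun v => φ (x - c - (k * δ + v)) * (Real.cos (n * (k * δ + v)) * cellAvg P δ (k * δ + v))) (Set.Ioo 0 δ) := by
    intro x k v hv
    beta_reduce
    rw [cellAvg_eq P hδ0 k hv.1.le hv.2, cos_shift hn, show x - (c + k * δ) - v = x - c - (k * δ + v) by ring]; ring
  have hi0 : ∀ x (k : ℕ), IntervalIntegrable (fun v => φ (x - (c + k * δ) - v) * Real.cos (n * v) * ((-1)^k * cellP P δ k)) volume 0 δ :=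
    fun x k => ((loc_sub hloc _ _ _).mul_continuousOn (by fun_prop)).mul_const _
  have hae : ∀ x (k : ℕ), (fun v => φ (x - (c + k * δ) - v) * Real.cos (n * v) * ((-1)^k * cellP P δ k)) =ᵐ[volume.restrict (Set.uIoc 0 δ)]
      (fun v => φ (x - c - (k * δ + v)) * (Real.cos (n * (k * δ + v)) * cellAvg P δ (k * δ + v))) := by
    intro x k
    rw [Set.uIoc_of_le hδ0.le, ← restrict_Ioo_eq_restrict_Ioc]
    exact (ae_restrict_iff' measurableSet_Ioo).2 (Eventually.of_forall (piece x k))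
  have e : (fun x => ∫ s in (0:ℝ)..(2 * π), φ (x - c - s) * (Real.cos (n * s) * cellAvg P δ s)) =
      ∑ k ∈ Finset.range (2 * n), fun x => (∫ v in (0:ℝ)..δ, φ (x - (c + k * δ) - v) * Real.cos (n * v)) * ((-1)^k * cellP P δ k) := by
    funext x
    rw [Finset.sum_apply]
    have := intervalIntegral.sum_integral_adjacent_intervals (f := fun s => φ (x - c - s) * (Real.cos (n * s) * cellAvg P δ s))
      (μ := volume) (a := fun k : ℕ => (k:ℝ) * δ) (n := 2 * n) (fun k _ => by
        have h1 := (hi0 x k).congr_ae (hae x k)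
        have h2 := h1.comp_sub_right (k * δ)
        simp only [add_sub_cancel] at h2
        have e1 : (0:ℝ) + k * δ = k * δ := by ring
        have e2 : δ + k * δ = ((k+1 : ℕ):ℝ) * δ := by push_cast; ring
        rwa [e1, e2] at h2)
    rw [h2] at this
    simp only [Nat.cast_zero, zero_mul] at this
    rw [← this]
    apply Finset.sum_congr rfl
    intro k _
    rw [← intervalIntegral.integral_mul_const, intervalIntegral.integral_congr_ae_restrict (hae x k)]
    have := intervalIntegral.integral_comp_add_left (a := 0) (b := δ) (fun s => φ (x - c - s) * (Real.cos (n * s) * cellAvg P δ s)) (k * δ)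
    rw [this]; push_cast; congr 1 <;> ring
  rw [e]
  have hmeas : ∀ k ∈ Finset.range (2 * n), AEStronglyMeasurable (fun x => (∫ v in (0:ℝ)..δ, φ (x - (c + k * δ) - v) * Real.cos (n * v)) * ((-1)^k * cellP P δ k)) PM := by
    intro k _
    refine AEStronglyMeasurable.mul_const ?_ _
    have h1 := (jm_sub hφ (c + k * δ) 0 δ).mul ((by fun_prop : Continuous (Function.uncurry fun (_x : ℝ) t => Real.cos (n * t))).aestronglyMeasurable)
    have h3 := h1.integral_prod_right'
    simp_rw [intervalIntegral.integral_of_le hδ0.le]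
    exact h3
  refine (eLpNorm_sum_le hmeas (by simp; linarith)).trans ?_
  have hb : ∀ k ∈ Finset.range (2*n), eLpNorm (fun x => (∫ v in (0:ℝ)..δ, φ (x - (c + k * δ) - v) * Real.cos (n * v)) * ((-1)^k * cellP P δ k)) (ENNReal.ofReal p) PM
      ≤ ENNReal.ofReal (cellP P δ k * (eN n ω / n)) := by
    intro k _
    have h1 := NN_smul p (fun x => (∫ v in (0:ℝ)..δ, φ (x - (c + k * δ) - v) * Real.cos (n * v))) ((-1)^k * cellP P δ k)
    unfold NN at h1
    rw [h1, ENNReal.ofReal_mul (hPk k), abs_mul, abs_pow, abs_neg, abs_one, one_pow, one_mul, abs_of_nonneg (hPk k)]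
    gcongr
    exact cell_bound hp hφ hper hloc hω hN hn _
  refine (Finset.sum_le_sum hb).trans ?_
  have heN : 0 ≤ eN n ω := by
    unfold eN
    apply intervalIntegral.integral_nonneg (by positivity)
    intro t ht
    exact mul_nonneg (hω.2.2.2.2 _ (by have := ht.1; positivity)) (Real.sin_nonneg_of_nonneg_of_le_pi ht.1 (by linarith [ht.2]))
  rw [← ENNReal.ofReal_sum_of_nonneg (fun k _ => mul_nonneg (hPk k) (by positivity)), ← Finset.sum_mul, cellP_sum hP, h2]
  apply ENNReal.ofReal_le_ofReal (le_of_eq _)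
  rw [hδ]; field_simp


lemma good_a {ψ η : ℝ → ℝ} (h : IsMInfPlus ψ η) {n : ℕ} (hn : 1 ≤ n) (hmu : 2 < (n:ℝ) / (η n - n)) :
    GoodSeq (fun j : ℕ => ψ (n + j)) := by
  have hn1 : (1:ℝ) ≤ n := by exact_mod_cast hn
  refine ⟨fun j => (h.1 _ ?_).le, ?_, ?_, (psi_sum_bound h n hn hmu).1⟩
  · have : (0:ℝ) ≤ j := by positivity
    show (1:ℝ) ≤ n + j
    linarith
  · intro i j hij
    have h1 : (i:ℝ) ≤ j := by exact_mod_cast hij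
    have : (0:ℝ) ≤ i := by positivity
    exact psi_antitone h (by show (1:ℝ) ≤ n + i; linarith) (by show (1:ℝ) ≤ n + j; linarith) (by linarith)
  · intro j
    have h0 : (0:ℝ) ≤ j := by positivity
    have := h.2.2.1.2 (x := n + j) (by show (1:ℝ) ≤ n + j; linarith) (y := n + (j + 2)) (by show (1:ℝ) ≤ n + (j+2); linarith)
      (by norm_num : (0:ℝ) ≤ 1/2) (by norm_num : (0:ℝ) ≤ 1/2) (by norm_num)
    simp only [smul_eq_mul] at this
    rw [show 1 / 2 * ((n:ℝ) + j) + 1 / 2 * (n + (j + 2)) = n + (j + 1) by ring] at this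
    push_cast
    linarith

def TT (ψ : ℝ → ℝ) (θ : ℝ) (n : ℕ) (t : ℝ) : ℝ :=
  (∑ k ∈ Finset.range (n - 1), ψ ((k + 1 : ℕ) : ℝ) * Real.cos (((k + 1 : ℕ) : ℤ) * t + (-θ))) +
  (-1) * ∑ j ∈ Finset.range (2 * n - 1), ψ (n + (j + 1)) * Real.cos (((n : ℤ) - (j + 1) : ℤ) * t + (-θ))

lemma TT_tp (ψ : ℝ → ℝ) (θ : ℝ) {n : ℕ} : IsTrigPoly n (TT ψ θ n) := by
  unfold TT
  apply tp_add
  · apply tp_sum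
    intro k hk
    rw [Finset.mem_range] at hk
    exact tp_smul _ (tp_cos _ (by simp; omega) _)
  · apply tp_smul
    apply tp_sum
    intro k hk
    rw [Finset.mem_range] at hk
    exact tp_smul _ (tp_cos _ (by omega) _)

lemma kernel {ψ η : ℝ → ℝ} (h : IsMInfPlus ψ η) {n : ℕ} (hn : 1 ≤ n) (hmu : 2 < (n:ℝ) / (η n - n)) (β t : ℝ) :
    PsiKer ψ β t = Real.cos (n * t - β * π / 2) * PP (fun j : ℕ => ψ (n + j)) t + TT ψ (β * π / 2) n t
      - QQ (fun m : ℕ => ψ (3 * n + m)) n (β * π / 2) t := by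
  set θ := β * π / 2 with hθ
  have hg := good_a h hn hmu
  set a : ℕ → ℝ := fun j : ℕ => ψ (n + j) with ha
  set G : ℕ → ℝ := fun k => ψ k * Real.cos (k * t - θ) with hG
  set H : ℕ → ℝ := fun j => a (j + 1) * Real.cos (((n : ℤ) - (j + 1) : ℤ) * t + (-θ)) with hH
  have sG : Summable (fun j => G (j + n)) := by
    refine Summable.of_norm_bounded hg.summ (fun j => ?_)
    have := Qterm hg.nonneg (fun j => Real.cos (((j + n : ℕ):ℝ) * t - θ)) (fun j => Real.abs_cos_le_one _) j
    simp only [hG, ha] at this ⊢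
    push_cast at this ⊢
    rwa [add_comm (n:ℝ) j] at this ⊢
  have sa : Summable (fun j => a (j+1)) := (summable_nat_add_iff 1).2 hg.summ
  have sH : Summable H := by
    refine Summable.of_norm_bounded sa (fun j => ?_)
    exact Qterm (fun j => hg.nonneg (j+1)) (fun j => Real.cos (((n : ℤ) - (j + 1) : ℤ) * t + (-θ))) (fun j => Real.abs_cos_le_one _) j
  have sG1 : Summable (fun k => G (k + 1)) := by
    rw [← summable_nat_add_iff (n - 1)]
    refine sG.congr (fun j => ?_)
    congr 1; omega
  have e1 : PsiKer ψ β t = ∑ k ∈ Finset.range (n-1), G (k+1) + ∑' j, G (j + n) := by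
    have : PsiKer ψ β t = ∑' k, G (k + 1) := by
      unfold PsiKer; simp only [hG]; push_cast; rfl
    rw [this, ← sG1.sum_add_tsum_nat_add (n-1)]
    congr 2; funext j; congr 1; omega
  have e2 : Real.cos (n * t - θ) * PP a t = ∑' j, G (j + n) + ∑' j, H j := by
    unfold PP
    rw [← tsum_mul_left, ((PP_summable hg t).mul_left _).tsum_eq_zero_add, sG.tsum_eq_zero_add, add_assoc,
      ← ((summable_nat_add_iff 1).2 sG).tsum_add sH]
    congr 1
    · simp [ee, hG, ha]; ring
    · congr 1; funext j
      have : ee (j+1) t = 2 * Real.cos ((j+1 : ℕ) * t) := by simp [ee]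
      rw [this]
      simp only [hG, hH, ha]
      push_cast
      rw [show ((j:ℝ) + 1 + n) * t - θ = (n * t - θ) + (j+1) * t by ring,
        show ((n:ℝ) - (j + 1)) * t + -θ = (n * t - θ) - (j+1) * t by ring, Real.cos_add (n * t - θ), Real.cos_sub (n * t - θ),
        show (j:ℝ) + 1 + n = n + (j + 1) by ring]
      ring
  have e3 : ∑' j, H j = ∑ j ∈ Finset.range (2*n-1), H j + QQ (fun m : ℕ => ψ (3 * n + m)) n θ t := by
    rw [← sH.sum_add_tsum_nat_add (2*n-1)]
    congr 1
    unfold QQ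
    congr 1; funext m
    simp only [hH, ha]
    have c1 : ((m + (2 * n - 1) + 1 : ℕ) : ℝ) = m + 2 * n := by
      rw [show m + (2 * n - 1) + 1 = m + 2 * n by omega]; push_cast; ring
    have c2 : (((n:ℤ) - (((m + (2 * n - 1) : ℕ) : ℤ) + 1) : ℤ) : ℝ) = -(n + m) := by
      rw [show ((n:ℤ) - (((m + (2 * n - 1) : ℕ) : ℤ) + 1)) = -(n + m) by omega]; push_cast; ring
    rw [c1, c2, ← Real.cos_neg]
    congr 2 <;> ring
  have e4 : TT ψ θ n t = ∑ k ∈ Finset.range (n-1), G (k+1) - ∑ j ∈ Finset.range (2*n-1), H j := by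
    unfold TT
    simp only [hG, hH, ha]
    push_cast
    simp only [sub_eq_add_neg]
    ring
  rw [e1, e2, e4, e3]; ring

lemma num_bound {ψ η : ℝ → ℝ} (h : IsMInfPlus ψ η) {n : ℕ} (hn : 1 ≤ n) (hmu : 2 < (n:ℝ) / (η n - n)) :
    (∑' j : ℕ, ψ (n + ((j + 1 : ℕ) : ℝ))) / n ≤ 8 * (ψ (n+1) * (1 / n + 1 / ((n : ℝ) / (η n - n) - 2))) ∧
    (∑' m : ℕ, ψ (3 * n + m) ≤ 4 * (1 + 3 * (η n - n)) * ψ (3 * n + (0:ℕ))) ∧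
    Summable (fun m : ℕ => ψ (3 * n + m)) ∧
    Real.log (1 + π * (1 + 3 * (η n - n))) ≤ 16 * (1 + max 0 (Real.log (η n - n))) := by
  have hn1 : (1:ℝ) ≤ n := by exact_mod_cast hn
  have hd := (h.2.2.2.2.1 n hn1).1
  have hmono := h.2.2.2.2.2.1
  have m1 := hmono (a := (n:ℝ)) hn1 (b := ((n+1 : ℕ):ℝ)) (by show (1:ℝ) ≤ ((n+1 : ℕ):ℝ); push_cast; linarith) (by push_cast; linarith)
  have m3 := hmono (a := (n:ℝ)) hn1 (b := ((3*n : ℕ):ℝ)) (by show (1:ℝ) ≤ ((3*n : ℕ):ℝ); push_cast; linarith) (by push_cast; linarith)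
  have hd1 := (h.2.2.2.2.1 ((n+1 : ℕ):ℝ) (by push_cast; linarith)).1
  have hd3 := (h.2.2.2.2.1 ((3*n : ℕ):ℝ) (by push_cast; linarith)).1
  beta_reduce at m1 m3
  have s1 := psi_sum_bound h (n+1) (by omega) (hmu.trans_le m1)
  have s3 := psi_sum_bound h (3*n) (by omega) (hmu.trans_le m3)
  have p1 := h.1 ((n+1 : ℕ):ℝ) (by push_cast; linarith)
  have p3 := h.1 ((3*n : ℕ):ℝ) (by push_cast; linarith)
  push_cast at m1 m3 hd1 hd3 s1 s3 p1 p3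
  set d := η n - n with hdd
  have d0 : 0 < d := by linarith
  set d1 := η (n+1) - (n+1) with hdd1
  set d3 := η (3*n) - 3*n with hdd3
  have d10 : 0 < d1 := by linarith
  have d30 : 0 < d3 := by linarith
  have b3 : d3 ≤ 3 * d := by
    rw [div_le_div_iff₀ d0 d30] at m3
    have : n * d3 ≤ n * (3 * d) := by linarith
    exact le_of_mul_le_mul_left this (by linarith)
  have b1 : d1 ≤ 2 * d := by
    rw [div_le_div_iff₀ d0 d10] at m1
    have : n * d1 ≤ n * (2 * d) := by nlinarith
    exact le_of_mul_le_mul_left this (by linarith)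
  have pn : (0:ℝ) < n := by linarith
  refine ⟨?_, ?_, s3.1, ?_⟩
  · have e : (∑' j : ℕ, ψ (n + ((j + 1 : ℕ) : ℝ))) = ∑' m : ℕ, ψ (n + 1 + m) := by
      congr 1; funext j; congr 1; push_cast; ring
    rw [e, div_le_iff₀ pn]
    refine s1.2.trans ?_
    have hq : d / n ≤ 1 / (n / d - 2) := by
      rw [← one_div_div]
      apply one_div_le_one_div_of_le (by linarith) (by linarith)
    have hq2 : d ≤ 1 / (n / d - 2) * n := (div_le_iff₀ pn).1 hq
    have : 8 * (ψ (n + 1) * (1 / n + 1 / (n / d - 2))) * n = ψ (n+1) * (8 + 8 * (1 / (n / d - 2) * n)) := by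
      field_simp
    rw [this]
    gcongr ?_ * ?_
    linarith
  · refine s3.2.trans ?_
    simp only [Nat.cast_zero, add_zero]
    have : 1 + 4 * d3 ≤ 4 * (1 + 3 * d) := by linarith
    nlinarith
  · set M := max 1 d with hM
    have hM1 : 1 ≤ M := le_max_left _ _
    have hM2 : d ≤ M := le_max_right _ _
    have h4 := Real.pi_le_four
    have hpi := pi_pos
    have hle : 1 + π * (1 + 3 * d) ≤ 17 * M := by nlinarith
    have h1 := Real.log_le_log (by positivity) hle
    rw [Real.log_mul (by norm_num) (by linarith)] at h1
    have h2 := Real.log_le_sub_one_of_pos (by norm_num : (0:ℝ) < 17)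
    have h3 : Real.log M ≤ max 0 (Real.log d) := by
      rcases le_total d 1 with hd' | hd'
      · rw [hM, max_eq_left hd']; simp
      · rw [hM, max_eq_right hd']; exact le_max_right _ _
    have h5 : 0 ≤ max 0 (Real.log d) := le_max_left _ _
    linarith


lemma NN_diff {p : ℝ} (hp : 1 < p) {φ ω : ℝ → ℝ} (hφ : MemLpP p φ) (hper : Function.Periodic φ (2 * π))
    (hω : ∀ t : ℝ, 0 ≤ t → ∀ h : ℝ, |h| ≤ t → LpNormP p (fun x => φ (x + h) - φ x) ≤ ω t) (h : ℝ) :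
    NN p (fun x => φ (x + h) - φ x) ≤ ENNReal.ofReal (ω |h|) := by
  have h1 := (memLp_iff hp hφ.1).2 hφ.2
  have h2 : MemLp (fun x => φ (x + h)) (ENNReal.ofReal p) PM := by
    refine ⟨(aesm_shift hφ.1 h).restrict, ?_⟩
    have := NN_per hp hper h
    unfold NN at this
    rw [this]; exact h1.2
  have h3 : MemLp (fun x => φ (x + h) - φ x) (ENNReal.ofReal p) PM := h2.sub h1
  rw [NN_eq_ofReal hp h3]
  exact ENNReal.ofReal_le_ofReal (hω _ (abs_nonneg _) h le_rfl)

lemma shift_conv {φ R : ℝ → ℝ} (hφ : Function.Periodic φ (2 * π)) (hR : Function.Periodic R (2 * π)) (c x : ℝ) :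
    ∫ t in (-π)..π, φ (x - t) * R t = ∫ s in (0:ℝ)..(2 * π), φ (x - c - s) * R (c + s) := by
  have hper : Function.Periodic (fun t => φ (x - t) * R t) (2 * π) := by
    intro t
    beta_reduce
    rw [hR t, show x - (t + 2 * π) = x - t - 2 * π by ring, hφ.sub_eq]
  have h1 := hper.intervalIntegral_add_eq (-π) c
  rw [show -π + 2 * π = π by ring] at h1
  have h2 := intervalIntegral.integral_comp_add_left (a := 0) (b := 2 * π) (fun t => φ (x - t) * R t) c
  rw [h1, ← add_zero c, add_assoc, zero_add, ← h2]
  simp only [add_zero]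
  congr 1; funext s; congr 2; ring

lemma one_f {C : ℝ} (hC : 0 < C) {p : ℝ} (hp : 1 < p) {ψ η : ℝ → ℝ} (h : IsMInfPlus ψ η) (β : ℝ) {ω : ℝ → ℝ} (hω : IsModulus ω)
    {n : ℕ} (hn : 1 ≤ n) (hmu : 2 < (n:ℝ) / (η n - n)) {J : ℝ → ℝ} (hJ : IsTrigPoly n J) (hJ1 : ∫ t in (-π)..π, J t = 1)
    (hJC : ∫ t in (-π)..π, |J t| * (1 + n * |t|) ≤ C) {f : ℝ → ℝ} (hf : f ∈ LpClass p ψ β ω)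
    {B : ℝ} (hBnn : 0 ≤ B)
    (hB : B = (2 / π) * ψ n * eN n ω + (2048 * C) * gammaN ψ η n * ω (1 / n)) :
    EnLp p n f ≤ B := by
  obtain ⟨hfL, hfper, a₀, φ, hφL, hper, -, hφω, hae⟩ := hf
  have hpi := pi_pos
  have hn1 : (1:ℝ) ≤ n := by exact_mod_cast hn
  have hn0 : (0:ℝ) < n := by linarith
  have hloc := loc_int hp hφL hper
  have hN := NN_diff hp hφL hper hφω
  have hg := good_a h hn hmu
  obtain ⟨nb1, nb2, nb3, nb4⟩ := num_bound h hn hmu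
  have hd := (h.2.2.2.2.1 n hn1).1
  have hω1 : 0 ≤ ω (1/n) := hω.2.2.2.2 _ (by positivity)
  set θ := β * π / 2 with hθ
  set a : ℕ → ℝ := fun j : ℕ => ψ (n + j) with ha
  set q : ℕ → ℝ := fun m : ℕ => ψ (3 * n + m) with hq
  have q0 : ∀ j, 0 ≤ q j := fun j => (h.1 _ (by have : (0:ℝ) ≤ j := by positivity
                                                show (1:ℝ) ≤ 3 * n + j
                                                linarith)).le
  have qa : Antitone q := by
    intro i j hij
    have h1 : (i:ℝ) ≤ j := by exact_mod_cast hij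
    have : (0:ℝ) ≤ i := by positivity
    exact psi_antitone h (by show (1:ℝ) ≤ 3 * n + i; linarith) (by show (1:ℝ) ≤ 3 * n + j; linarith) (by linarith)
  set t0 := θ / n with ht0
  set P : ℝ → ℝ := fun s => PP a (t0 + s) with hP
  have hPc : Continuous P := (PP_cont hg).comp (by fun_prop)
  have hP0 : ∀ t, 0 ≤ P t := fun t => PP_nonneg hg _
  set Q : ℝ → ℝ := QQ q n θ with hQ
  have hQc : Continuous Q := QQ_cont q0 nb3 n θ
  set pA := cellAvg P (π/n) with hpA
  set W : ℝ → ℝ := fun s => Real.cos (n * s) * (P s - pA s) - Q (t0 + s) with hW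
  set T0 := TT ψ θ n with hT0
  have hT0tp : IsTrigPoly n T0 := TT_tp ψ θ
  -- bounds on P
  have hPb : ∃ D, ∀ t, |P t| ≤ D := by
    refine ⟨2 * ∑' j, a j, fun t => ?_⟩
    have := tsum_of_norm_bounded (hg.summ.mul_left 2).hasSum (fun l => term_le hg l (t0 + t))
    rw [tsum_mul_left] at this
    exact this
  obtain ⟨D, hD⟩ := hPb
  have hδ0 : 0 < π / n := by positivity
  have hpAb : ∀ t, |pA t| ≤ D := cellAvg_bound hδ0 hD
  have hpAm : Measurable pA := cellAvg_meas _ _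
  have hWm : Measurable W := by
    have : Measurable Q := hQc.measurable
    have : Measurable P := hPc.measurable
    simp only [hW]
    fun_prop
  have hD0 : 0 ≤ D := (abs_nonneg _).trans (hD 0)
  have hQb : ∀ t, |Q t| ≤ ∑' j, q j := QQ_bound q0 nb3 n θ
  have hdiff : ∀ s, |Real.cos (n * s) * (P s - pA s)| ≤ |P s - pA s| := by
    intro s
    rw [abs_mul]
    have := Real.abs_cos_le_one (n * s)
    nlinarith [abs_nonneg (P s - pA s)]
  have hWb : ∀ s, |W s| ≤ 2 * D + ∑' j, q j := by
    intro s
    have h1 := abs_sub (Real.cos (n * s) * (P s - pA s)) (Q (t0 + s))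
    have h2 := abs_sub (P s) (pA s)
    have := hdiff s
    have := hD s; have := hpAb s; have := hQb (t0 + s)
    simp only [hW]; linarith
  have bint : ∀ (g : ℝ → ℝ) (E : ℝ), Measurable g → (∀ s, |g s| ≤ E) → ∀ a b, IntervalIntegrable g volume a b := by
    intro g E hgm hgE a b
    refine (intervalIntegrable_const (c := E)).mono_fun hgm.aestronglyMeasurable (Eventually.of_forall fun t => ?_)
    show |g t| ≤ |E|
    exact (hgE t).trans (le_abs_self _)
  have hWi : ∀ a b, IntervalIntegrable W volume a b := bint W _ hWm hWb
  have cint : ∀ (u g : ℝ → ℝ) (E : ℝ), (∀ a b, IntervalIntegrable u volume a b) → Measurable g → (∀ s, |g s| ≤ E) →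
      ∀ y a b, IntervalIntegrable (fun s => u (y - s) * g s) volume a b := by
    intro u g E hu hgm hgE y a b
    have := loc_sub hu y a b
    rw [intervalIntegrable_iff] at this ⊢
    exact this.mul_bdd (c := E) hgm.aestronglyMeasurable (Eventually.of_forall fun t => by rw [Real.norm_eq_abs]; exact hgE t)
  -- L1 bound on W
  have hWL1 : ∫ s in (0:ℝ)..(2 * π), |W s| ≤ 2048 * gammaN ψ η n := by
    have w1 : ∫ s in (0:ℝ)..(2 * π), |P s - pA s| ≤ 2 * (8 * π * ∑' j, a (j+1)) * (π / n) := by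
      apply cellAvg_total hPc hδ0 hD
      intro s
      have := PP_mod hg s
      have hpp : Function.Periodic (fun t => |PP a (t + s) - PP a t|) (2 * π) := by
        intro t
        beta_reduce
        rw [PP_per t, show t + 2 * π + s = t + s + 2 * π by ring, PP_per]
      have h1 := intervalIntegral.integral_comp_add_left (a := 0) (b := 2 * π) (fun t => |PP a (t + s) - PP a t|) t0
      have h2 := hpp.intervalIntegral_add_eq t0 0
      rw [zero_add] at h2
      rw [add_zero, h2] at h1
      have e : (fun t => |P (t + s) - P t|) = fun t => |PP a (t0 + t + s) - PP a (t0 + t)| := by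
        funext t; simp only [hP, add_assoc]
      rw [e, h1]
      linarith
    have w2 : ∫ s in (0:ℝ)..(2 * π), |Q (t0 + s)| ≤ 16 * q 0 * Real.log (1 + π * (1 + 3 * (η n - n))) :=
      QQ_L1 q0 qa nb3 n θ t0 (by linarith) nb2
    have i1 : IntervalIntegrable (fun s => |P s - pA s|) volume 0 (2 * π) :=
      bint _ (2 * D) (hPc.measurable.sub hpAm).abs (fun s => by
        rw [abs_abs]
        show |P s - pA s| ≤ 2 * D
        have h2 := abs_sub (P s) (pA s)
        have := hD s; have := hpAb s
        linarith) _ _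
    have i2 : IntervalIntegrable (fun s => |Q (t0 + s)|) volume 0 (2 * π) := (by fun_prop : Continuous fun s => |Q (t0 + s)|).intervalIntegrable _ _
    have w3 : ∫ s in (0:ℝ)..(2 * π), |W s| ≤ ∫ s in (0:ℝ)..(2 * π), (|P s - pA s| + |Q (t0 + s)|) := by
      apply intervalIntegral.integral_mono_on (by positivity) (hWi _ _).abs (i1.add i2)
      intro s _
      have h1 := abs_sub (Real.cos (n * s) * (P s - pA s)) (Q (t0 + s))
      have := hdiff s
      simp only [hW]; linarith
    rw [intervalIntegral.integral_add i1 i2] at w3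
    have hq00 : q 0 = ψ (3 * n) := by simp [hq]
    have hp1 := (h.1 (n+1) (by linarith)).le
    have hp3 : 0 ≤ q 0 := q0 0
    have g1 : 2 * (8 * π * ∑' j, a (j+1)) * (π / n) ≤ 2048 * (ψ (n+1) * (1 / n + 1 / ((n : ℝ) / (η n - n) - 2))) := by
      have e : 2 * (8 * π * ∑' j, a (j+1)) * (π / n) = 16 * π^2 * ((∑' j, a (j+1)) / n) := by ring
      have hpp : π ^ 2 ≤ 16 := by nlinarith [Real.pi_le_four]
      have hs0 : 0 ≤ (∑' j, a (j+1)) / n := div_nonneg (tsum_nonneg fun j => hg.nonneg _) hn0.le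
      have : (∑' j, a (j+1)) / n ≤ 8 * (ψ (n+1) * (1 / n + 1 / ((n : ℝ) / (η n - n) - 2))) := nb1
      rw [e]
      calc 16 * π^2 * ((∑' j, a (j+1)) / n) ≤ 16 * 16 * ((∑' j, a (j+1)) / n) := by gcongr
        _ ≤ _ := by linarith
    have hmx : 0 ≤ max 0 (Real.log (η n - n)) := le_max_left _ _
    have g2 : 16 * q 0 * Real.log (1 + π * (1 + 3 * (η n - n))) ≤ 2048 * (ψ (3 * n) * (1 + max 0 (Real.log (η n - n)))) := by
      rw [← hq00]
      calc _ ≤ 16 * q 0 * (16 * (1 + max 0 (Real.log (η n - n)))) := by gcongr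
        _ = 256 * (q 0 * (1 + max 0 (Real.log (η n - n)))) := by ring
        _ ≤ _ := by gcongr; norm_num
    unfold gammaN
    linarith
  -- the polynomial
  set φJ : ℝ → ℝ := fun x => ∫ t in (-π)..π, φ (x - t) * J t with hφJ
  have hφJtp : IsTrigPoly n φJ := by
    have := tp_conv hJ (hloc (-π) π) 0
    simp only [sub_zero] at this
    have e : φJ = fun x => ∫ t in (-π)..π, J (x - t) * φ t := by
      funext x; exact conv_swap hper (tp_per hJ) x
    rw [e]; exact this
  set φt : ℝ → ℝ := fun x => φ x - φJ x with hφt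
  have hφtN : NN p φt ≤ ENNReal.ofReal (C * ω (1/n)) := tilde_bound hp hφL.1 hloc hω hN hn (tp_cont hJ) hJ1 hJC
  have hφJc := tp_cont hφJtp
  have hφtm : AEStronglyMeasurable φt volume := hφL.1.sub hφJc.aestronglyMeasurable
  have hφtper : Function.Periodic φt (2 * π) := by
    intro x; simp only [hφt]; rw [hper x, tp_per hφJtp x]
  have hφtloc : ∀ a b, IntervalIntegrable φt volume a b := fun a b => (hloc a b).sub (hφJc.intervalIntegrable _ _)
  set T : ℝ → ℝ := fun x => a₀ / 2 + (1/π) * ((∫ t in (-π)..π, T0 (x - t) * φ t) + ∫ s in (0:ℝ)..(2*π), φJ (x - t0 - s) * W s) with hT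
  have hTtp : IsTrigPoly n T := by
    refine tp_add (tp_const hn _) (tp_smul _ (tp_add ?_ (tp_conv hφJtp (hWi _ _) t0)))
    have := tp_conv hT0tp (hloc (-π) π) 0
    simpa only [sub_zero] using this
  set M1 : ℝ → ℝ := fun x => ∫ s in (0:ℝ)..(2 * π), φ (x - t0 - s) * (Real.cos (n * s) * pA s) with hM1
  set M2 : ℝ → ℝ := fun x => ∫ s in (0:ℝ)..(2 * π), φt (x - t0 - s) * W s with hM2
  have hpoint : ∀ x, (a₀ / 2 + (1 / π) * ∫ t in (-π)..π, φ (x - t) * PsiKer ψ β t) - T x = (M1 x + M2 x) * (1/π) := by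
    intro x
    set R : ℝ → ℝ := fun t => Real.cos (n * t - θ) * PP a t - Q t with hR
    have hRc : Continuous R := by
      have := PP_cont hg
      simp only [hR]; fun_prop
    have hRper : Function.Periodic R (2 * π) := by
      intro t
      simp only [hR]
      rw [PP_per, hQ, QQ_per n θ t, show (n:ℝ) * (t + 2 * π) - θ = (n * t - θ) + n * (2 * π) by ring, Real.cos_add_nat_mul_two_pi]
    have k1 : ∫ t in (-π)..π, φ (x - t) * PsiKer ψ β t = (∫ t in (-π)..π, φ (x - t) * T0 t) + ∫ t in (-π)..π, φ (x - t) * R t := by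
      rw [← intervalIntegral.integral_add ((loc_sub hloc x _ _).mul_continuousOn (tp_cont hT0tp).continuousOn)
        ((loc_sub hloc x _ _).mul_continuousOn hRc.continuousOn)]
      congr 1; funext t
      rw [kernel h hn hmu β t]
      simp only [hR]; ring
    have k2 : ∫ t in (-π)..π, φ (x - t) * R t = M1 x + (M2 x + ∫ s in (0:ℝ)..(2*π), φJ (x - t0 - s) * W s) := by
      rw [shift_conv hper hRper t0 x]
      simp only [hM1, hM2]
      have j2 := cint φt W _ hφtloc hWm hWb (x - t0) 0 (2*π)
      have j3 := cint φJ W _ (fun a b => hφJc.intervalIntegrable a b) hWm hWb (x - t0) 0 (2*π)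
      have j1 := cint φ (fun s => Real.cos (n * s) * pA s) D hloc (by fun_prop) (fun s => by
        rw [abs_mul]
        have := Real.abs_cos_le_one (n * s)
        have := hpAb s
        nlinarith [abs_nonneg (pA s)]) (x - t0) 0 (2*π)
      rw [← intervalIntegral.integral_add j2 j3, ← intervalIntegral.integral_add j1 (j2.add j3)]
      congr 1; funext s
      simp only [hR, hφt, hW, hP]
      have : n * (t0 + s) - θ = n * s := by rw [ht0]; field_simp; ring
      rw [this]; ring
    rw [k1, k2, conv_swap hper (tp_per hT0tp) x]
    simp only [hT]; ring
  have hψn := (h.1 n hn1).le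
  have n1 : NN p M1 ≤ ENNReal.ofReal (2 * ψ n * eN n ω) := by
    have := main_bound hp hφL.1 hper hloc hω hN hn t0 hPc hP0
    refine this.trans (ENNReal.ofReal_le_ofReal (le_of_eq ?_))
    rw [PP_integral hg t0]
    simp only [ha, Nat.cast_zero, add_zero]
    field_simp
  have n2 : NN p M2 ≤ ENNReal.ofReal (C * ω (1/n) * (2048 * gammaN ψ η n)) := by
    refine (Wconv hp hφtm hφtper (by positivity) hφtN (by positivity) (hWi 0 (2*π)) t0).trans (ENNReal.ofReal_le_ofReal ?_)
    gcongr
  have meas1 : AEStronglyMeasurable M1 PM := by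
    have h1 := (jm_sub hφL.1 t0 0 (2*π)).mul (((by fun_prop : Measurable (fun s => Real.cos (n * s) * pA s)).comp measurable_snd).aestronglyMeasurable)
    have h3 := h1.integral_prod_right'
    simp only [hM1, intervalIntegral.integral_of_le (by positivity : (0:ℝ) ≤ 2 * π)]
    exact h3
  have meas2 : AEStronglyMeasurable M2 PM := by
    have h1 := (jm_sub hφtm t0 0 (2*π)).mul ((hWm.comp measurable_snd).aestronglyMeasurable)
    have h3 := h1.integral_prod_right'
    simp only [hM2, intervalIntegral.integral_of_le (by positivity : (0:ℝ) ≤ 2 * π)]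
    exact h3
  have heN : 0 ≤ eN n ω := by
    unfold eN
    apply intervalIntegral.integral_nonneg (by positivity)
    intro t ht
    exact mul_nonneg (hω.2.2.2.2 _ (by have := ht.1; positivity)) (Real.sin_nonneg_of_nonneg_of_le_pi ht.1 (by linarith [ht.2]))
  have hγ : 0 ≤ gammaN ψ η n := by
    have := intervalIntegral.integral_nonneg (μ := volume) (by positivity : (0:ℝ) ≤ 2 * π) (fun s _ => abs_nonneg (W s))
    linarith
  have n3 : NN p (fun x => M1 x + M2 x) ≤ ENNReal.ofReal (2 * ψ n * eN n ω + C * ω (1/n) * (2048 * gammaN ψ η n)) := by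
    rw [ENNReal.ofReal_add (by positivity) (by positivity)]
    exact (eLpNorm_add_le meas1 meas2 (by simp; linarith)).trans (add_le_add n1 n2)
  have n4 : NN p (fun x => f x - T x) ≤ ENNReal.ofReal B := by
    have e : NN p (fun x => f x - T x) = NN p (fun x => (M1 x + M2 x) * (1/π)) := by
      apply eLpNorm_congr_ae
      refine ae_restrict_of_ae ?_
      filter_upwards [hae] with x hx
      rw [hx, hpoint x]
    rw [e, NN_smul, abs_of_pos (by positivity)]
    refine (mul_le_mul_right n3 _).trans ?_
    rw [← ENNReal.ofReal_mul (by positivity)]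
    apply ENNReal.ofReal_le_ofReal
    rw [hB]
    have h1 : 1/π ≤ 1 := by rw [div_le_one hpi]; linarith [Real.two_le_pi]
    have h2 : 0 ≤ C * ω (1/n) * (2048 * gammaN ψ η n) := by positivity
    have h3 : 1/π * (C * ω (1/n) * (2048 * gammaN ψ η n)) ≤ 1 * (C * ω (1/n) * (2048 * gammaN ψ η n)) := by gcongr
    have h4 : 1/π * (2 * ψ n * eN n ω) = 2 / π * ψ n * eN n ω := by ring
    rw [mul_add, h4]
    linarith
  have n5 := LpNormP_le hp (hfL.1.sub (tp_cont hTtp).aestronglyMeasurable) hBnn n4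
  refine le_trans (csInf_le ⟨0, ?_⟩ ⟨T, hTtp, rfl⟩) n5
  rintro e ⟨S, -, rfl⟩
  unfold LpNormP
  apply Real.rpow_nonneg
  apply intervalIntegral.integral_nonneg (by linarith)
  intro x _; positivity

/-- For `1 < p < ∞` and arbitrary moduli of continuity,
`E_n(L^ψ_β H_{ω_{L_p}})_{L_p} ≤ (2/π) ψ(n) e_n(ω) + K γ_n(ψ) ω(1/n)` whenever `μ(n) > 2`. -/
theorem statement4 :
    ∃ K : ℝ, 0 < K ∧ ∀ p : ℝ, 1 < p → ∀ ψ η : ℝ → ℝ, IsMInfPlus ψ η →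
      ∀ β : ℝ, ∀ ω : ℝ → ℝ, IsModulus ω → ∀ n : ℕ,
      2 < (n : ℝ) / (η n - n) →
      EnLpClass p n (LpClass p ψ β ω) ≤
        (2 / π) * ψ n * eN n ω + K * gammaN ψ η n * ω (1 / n) := by
  obtain ⟨C, hC, hJ⟩ := jackson
  refine ⟨2048 * C, by positivity, ?_⟩
  intro p hp ψ η h β ω hω n hmu
  have hpi := pi_pos
  have hn : 1 ≤ n := by
    rcases Nat.eq_zero_or_pos n with rfl | h0
    · norm_num at hmu
    · exact h0
  obtain ⟨J, hJt, hJ1, hJC⟩ := hJ n hn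
  have hn1 : (1:ℝ) ≤ n := by exact_mod_cast hn
  have hψn := (h.1 n hn1).le
  have hω1 : 0 ≤ ω (1/n) := hω.2.2.2.2 _ (by positivity)
  have heN : 0 ≤ eN n ω := by
    unfold eN
    apply intervalIntegral.integral_nonneg (by positivity)
    intro t ht
    exact mul_nonneg (hω.2.2.2.2 _ (by have := ht.1; positivity)) (Real.sin_nonneg_of_nonneg_of_le_pi ht.1 (by linarith [ht.2]))
  have hγ : 0 ≤ gammaN ψ η n := by
    unfold gammaN
    have h1 := (h.1 (n+1) (by linarith)).le
    have h2 := (h.1 (3*n) (by linarith)).le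
    have h3 : 0 ≤ (n : ℝ) / (η n - n) - 2 := by linarith
    have h4 : 0 ≤ max 0 (Real.log (η n - n)) := le_max_left _ _
    positivity
  have hBnn : 0 ≤ (2 / π) * ψ n * eN n ω + (2048 * C) * gammaN ψ η n * ω (1 / n) := by positivity
  unfold EnLpClass
  apply Real.sSup_le _ hBnn
  rintro e ⟨f, hf, rfl⟩
  exact one_f hC hp h β hω hn hmu hJt hJ1 hJC hf hBnn rfl
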